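/- (a) Let K be a field of characteristic 2 containing the field F₄ with four elements (equivalently, char K = 2 and K contains a primitive cube root of unity). Then ed_K(S_{n+3}) ≥ ed_K(S_n) + 1 for every integer n ≥ 1 with n ≠ 4. (b) For any field K of characteristic 2, ed_K(S_n) ≥ ⌊(n+1)/3⌋ for every integer n ≥ 1. -/

import Mathlib

noncomputable section

/-- The transcendence degree of `L` over `K`: the supremum of the cardinalities of
algebraically independent subsets of `L`. -/
noncomputable def trdeg (K L : Type*) [CommRing K] [CommRing L] [Algebra K L] : Cardinal :=
  ⨆ s : {s : Set L // AlgebraicIndependent K ((↑) : s → L)}, Cardinal.mk s.1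

/-- The rational function field over `K` on variables indexed by `σ` :
the fraction field of the polynomial ring `K[x_i : i ∈ σ]`. -/
abbrev FnField (K : Type*) [Field K] (σ : Type*) : Type _ :=
  FractionRing (MvPolynomial σ K)

/-- Permutations of the variables acting on the polynomial ring by `K`-algebra
automorphisms. -/
noncomputable def permHom (K : Type*) [Field K] (σ : Type*) :
    Equiv.Perm σ →* (MvPolynomial σ K ≃ₐ[K] MvPolynomial σ K) where
  toFun e := MvPolynomial.renameEquiv K e
  map_one' := MvPolynomial.renameEquiv_refl K
  map_mul' e f := by
    ext x
    simp [MvPolynomial.renameEquiv, Equiv.Perm.mul_apply]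

/-- Permutations of the variables acting on the rational function field by
`K`-algebra automorphisms. -/
noncomputable def permGalAction (K : Type*) [Field K] (σ : Type*) :
    Equiv.Perm σ →* (FnField K σ ≃ₐ[K] FnField K σ) :=
  (IsFractionRing.fieldEquivOfAlgEquivHom K (FnField K σ)).comp (permHom K σ)

/-- The action of a group `G` on its rational function field `K(x_g : g ∈ G)` by
`K`-algebra automorphisms, permuting the variables by left translation:
`σ • x_g = x_{σg}`. -/
noncomputable def galAction (K : Type*) [Field K] (G : Type*) [Group G] :
    G →* (FnField K G ≃ₐ[K] FnField K G) :=
  (permGalAction K G).comp (MulAction.toPermHom G G)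

/-- The essential dimension of a group `G` over the field `K`:
the minimum of the transcendence degrees over `K` of the `G`-stable intermediate
subfields of the rational function field `K(x_g : g ∈ G)` on which `G` acts
faithfully. -/
noncomputable def edK (K : Type*) [Field K] (G : Type*) [Group G] : ℕ :=
  sInf { d : ℕ | ∃ E : IntermediateField K (FnField K G),
    (∀ g : G, ∀ x ∈ E, galAction K G g x ∈ E) ∧
    (∀ g : G, g ≠ 1 → ∃ x ∈ E, galAction K G g x ≠ x) ∧
    trdeg K E = d }

universe u

open MvPolynomial

theorem trdeg_eq_algebraTrdeg (K L : Type*) [CommRing K] [CommRing L] [Algebra K L] :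
    trdeg K L = Algebra.trdeg K L := rfl

/-- An intermediate field generated by `s` has transcendence degree bounded by the cardinalities of
the algebraically independent subsets of `s`. -/
theorem trdeg_adjoin_le {K M : Type*} [Field K] [Field M] [Algebra K M] (s : Set M)
    (c : Cardinal) (h : ∀ t ⊆ s, AlgebraicIndependent K ((↑) : t → M) → Cardinal.mk t ≤ c) :
    trdeg K (IntermediateField.adjoin K s) ≤ c := by
  set E := IntermediateField.adjoin K s
  let s' : Set E := Subtype.val ⁻¹' s
  have halg : ∀ (x : M) (hx : x ∈ E), IsAlgebraic (Algebra.adjoin K s') (⟨x, hx⟩ : E) := by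
    intro x hx
    induction hx using IntermediateField.adjoin_induction with
    | mem x hx =>
      exact isAlgebraic_algebraMap (A := E) (⟨⟨x, IntermediateField.subset_adjoin K s hx⟩,
        Algebra.subset_adjoin hx⟩ : Algebra.adjoin K s')
    | algebraMap x =>
      exact isAlgebraic_algebraMap (A := E) (algebraMap K (Algebra.adjoin K s') x)
    | add x y hx hy h₁ h₂ => exact h₁.add h₂
    | mul x y hx hy h₁ h₂ => exact h₁.mul h₂
    | inv x hx h₁ => exact h₁.inv
  have : Algebra.IsAlgebraic (Algebra.adjoin K s') E := ⟨fun x => halg x.1 x.2⟩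
  obtain ⟨t, hts, ht⟩ := exists_isTranscendenceBasis_subset (R := K) s'
  rw [trdeg_eq_algebraTrdeg, ← ht.cardinalMk_eq_trdeg, ← Cardinal.mk_image_eq
    (Subtype.val_injective (p := (· ∈ E)))]
  refine h _ (by rintro _ ⟨x, hx, rfl⟩; exact hts hx) ?_
  have h₁ := (ht.1.map' (f := E.val) E.val.injective).coe_range
  have h₂ : Set.range (E.val ∘ ((↑) : t → E)) = Subtype.val '' t := by
    rw [Set.range_comp, Subtype.range_coe]; rfl
  rwa [h₂] at h₁

/-- Lifting algebraically independent elements along `ψ` and adding an element of the kernel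
yields an algebraically independent family. -/
theorem AlgebraicIndependent.option_of_map_eq_zero {K B M ι : Type*} [Field K] [CommRing B]
    [IsDomain B] [CommRing M] [Algebra K B] [Algebra K M] (ψ : B →ₐ[K] M) (r : ι → B)
    (hr : AlgebraicIndependent K (ψ ∘ r)) (b : B) (hb : b ≠ 0) (hψ : ψ b = 0) :
    AlgebraicIndependent K (fun o : Option ι ↦ o.elim b r) := by
  refine AlgebraicIndependent.option_iff.2 ⟨hr.of_comp ψ, ?_⟩
  intro ⟨p, hp, hpb⟩
  have key : ∀ q : Polynomial (Algebra.adjoin K (Set.range r)), q.coeff 0 ≠ 0 →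
      Polynomial.aeval b q ≠ 0 := by
    intro q hq h0
    obtain ⟨q', hq'⟩ : ∃ q', q = Polynomial.X * q' + Polynomial.C (q.coeff 0) :=
      ⟨_, (Polynomial.X_mul_divX_add q).symm⟩
    have h1 : ψ (algebraMap _ B (q.coeff 0)) = 0 := by
      rw [hq'] at h0
      simp only [map_add, map_mul, Polynomial.aeval_X, Polynomial.aeval_C] at h0
      simpa [hψ] using congrArg ψ h0
    obtain ⟨P, hP⟩ : ((q.coeff 0 : _) : B) ∈ (aeval r : MvPolynomial ι K →ₐ[K] B).range := by
      rw [← Algebra.adjoin_range_eq_range_aeval]; exact (q.coeff 0).2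
    have h2 : aeval (ψ ∘ r) P = 0 := by
      have : aeval (ψ ∘ r) P = ψ (aeval r P) := by
        rw [← AlgHom.comp_apply]; congr 1; ext; simp
      rw [this]
      exact (congrArg ψ hP).trans h1
    have h3 : P = 0 := hr (h2.trans (map_zero _).symm)
    apply hq
    ext
    rw [← hP, h3]
    simp
  obtain ⟨q, hq, hq0⟩ := Polynomial.exists_eq_pow_rootMultiplicity_mul_and_not_dvd p hp 0
  simp only [map_zero, sub_zero] at hq hq0
  rw [Polynomial.X_dvd_iff] at hq0
  rw [hq, map_mul, map_pow, Polynomial.aeval_X] at hpb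
  exact (mul_ne_zero (pow_ne_zero _ hb) (key q hq0)) hpb

/-- A homomorphism `φ` from the polynomial ring to a field extends to the fractions whose
denominator does not vanish under `φ`. -/
theorem exists_extension_of_algHom {K S M : Type*} [Field K] [Field M] [Algebra K M]
    (φ : MvPolynomial S K →ₐ[K] M) :
    ∃ (A : Subalgebra K (FnField K S)) (ψ : A →ₐ[K] M),
      (∀ (x : FnField K S) (p q : MvPolynomial S K), φ q ≠ 0 →
        x * algebraMap _ _ q = algebraMap _ _ p → x ∈ A) ∧
      (∀ x ∈ A, ∃ p q : MvPolynomial S K, φ q ≠ 0 ∧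
        x * algebraMap _ _ q = algebraMap _ _ p) ∧
      (∀ (x : A) (p q : MvPolynomial S K),
        (x : FnField K S) * algebraMap _ _ q = algebraMap _ _ p → ψ x * φ q = φ p) := by
  let T : Submonoid (MvPolynomial S K) := (nonZeroDivisors M).comap φ
  have hT : ∀ q, q ∈ T ↔ φ q ≠ 0 := fun q => by
    simp [T, Submonoid.mem_comap, mem_nonZeroDivisors_iff_ne_zero]
  have hT0 : T ≤ nonZeroDivisors (MvPolynomial S K) := fun q hq => by
    rw [mem_nonZeroDivisors_iff_ne_zero]
    rintro rfl
    exact (hT 0).1 hq (map_zero _)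
  let A₀ := Localization.subalgebra.ofField (FnField K S) T hT0
  have hmem : ∀ x, x ∈ A₀ ↔ ∃ p q : MvPolynomial S K, φ q ≠ 0 ∧
      x * algebraMap _ _ q = algebraMap _ (FnField K S) p := by
    intro x
    change (∃ (a s : MvPolynomial S K) (_ : s ∈ T), x = algebraMap _ _ a * (algebraMap _ _ s)⁻¹) ↔ _
    refine exists_congr fun a => exists_congr fun s => ?_
    rw [hT, exists_prop]
    refine and_congr_right fun hs => ?_
    have : algebraMap _ (FnField K S) s ≠ 0 := by
      rw [Ne, FaithfulSMul.algebraMap_eq_zero_iff]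
      rintro rfl
      simp at hs
    rw [eq_mul_inv_iff_mul_eq₀ this]
  have hu : ∀ y : T, IsUnit (φ.toRingHom y) := fun y =>
    isUnit_iff_ne_zero.2 ((hT _).1 y.2)
  let ψ₀ : A₀ →+* M := IsLocalization.lift hu
  have hψ₀ : ∀ p, ψ₀ (algebraMap _ A₀ p) = φ p := fun p => IsLocalization.lift_eq hu p
  refine ⟨A₀.restrictScalars K, { ψ₀ with commutes' := fun k => ?_ }, ?_, ?_, ?_⟩
  · exact (hψ₀ (algebraMap K _ k)).trans (φ.commutes k)
  · exact fun x p q hq h => (hmem x).2 ⟨p, q, hq, h⟩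
  · exact fun x hx => (hmem x).1 hx
  · intro x p q h
    have h' : (show A₀ from x) * algebraMap _ A₀ q = algebraMap _ A₀ p := Subtype.ext h
    have := congrArg ψ₀ h'
    rw [map_mul, hψ₀, hψ₀] at this
    exact this

theorem permGalAction_algebraMap (K : Type*) [Field K] {S : Type*} (e : Equiv.Perm S)
    (p : MvPolynomial S K) :
    permGalAction K S e (algebraMap _ (FnField K S) p) = algebraMap _ _ (rename e p) := by
  change IsFractionRing.fieldEquivOfAlgEquiv K (FnField K S) (FnField K S) (permHom K S e) _ = _
  rw [IsFractionRing.fieldEquivOfAlgEquiv_algebraMap]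
  rfl

theorem galAction_apply (K G : Type*) [Field K] [Group G] (g : G) :
    galAction K G g = permGalAction K G (MulAction.toPerm g) := rfl

theorem edK_le_of {K G : Type*} [Field K] [Group G] (E : IntermediateField K (FnField K G))
    (h₁ : ∀ g : G, ∀ x ∈ E, galAction K G g x ∈ E)
    (h₂ : ∀ g : G, g ≠ 1 → ∃ x ∈ E, galAction K G g x ≠ x) {d : ℕ} (hd : trdeg K E ≤ d) :
    edK K G ≤ d := by
  obtain ⟨m, hm⟩ := Cardinal.lt_aleph0.1 (hd.trans_lt Cardinal.natCast_lt_aleph0)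
  rw [hm] at hd
  have hE : ∃ E : IntermediateField K (FnField K G), (∀ g : G, ∀ x ∈ E, galAction K G g x ∈ E) ∧
      (∀ g : G, g ≠ 1 → ∃ x ∈ E, galAction K G g x ≠ x) ∧ trdeg K E = m := ⟨E, h₁, h₂, hm⟩
  exact (Nat.sInf_le hE).trans (by exact_mod_cast hd)

theorem exists_trdeg_eq_edK (K : Type u) (G : Type) [Field K] [Group G] [Finite G] :
    ∃ E : IntermediateField K (FnField K G),
      (∀ g : G, ∀ x ∈ E, galAction K G g x ∈ E) ∧
      (∀ g : G, g ≠ 1 → ∃ x ∈ E, galAction K G g x ≠ x) ∧ trdeg K E = edK K G := by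
  suffices h : ∃ d : ℕ, ∃ E : IntermediateField K (FnField K G),
      (∀ g : G, ∀ x ∈ E, galAction K G g x ∈ E) ∧
      (∀ g : G, g ≠ 1 → ∃ x ∈ E, galAction K G g x ≠ x) ∧ trdeg K E = d from Nat.sInf_mem h
  have hle : trdeg K (⊤ : IntermediateField K (FnField K G)) ≤ (Nat.card G : Cardinal) := by
    have h₁ : trdeg K (⊤ : IntermediateField K (FnField K G)) = trdeg K (FnField K G) :=
      IntermediateField.topEquiv.trdeg_eq
    have h₂ := _root_.trdeg_add_eq K (MvPolynomial G K) (A := FnField K G)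
    have : Algebra.IsAlgebraic (MvPolynomial G K) (FnField K G) :=
      IsLocalization.isAlgebraic _ (nonZeroDivisors (MvPolynomial G K))
    rw [_root_.trdeg_eq_zero_iff.2 this, add_zero] at h₂
    rw [h₁, trdeg_eq_algebraTrdeg, ← h₂, MvPolynomial.trdeg_of_isDomain, ← Nat.cast_card]
    simp
  obtain ⟨m, hm⟩ := Cardinal.lt_aleph0.1 (hle.trans_lt Cardinal.natCast_lt_aleph0)
  refine ⟨m, ⊤, fun _ _ _ => trivial, fun g hg => ?_, hm⟩
  refine ⟨algebraMap _ _ (X 1 : MvPolynomial G K), trivial, ?_⟩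
  rw [galAction_apply, permGalAction_algebraMap]
  intro h
  have := X_injective (R := K) ((rename_X (MulAction.toPerm g) (1 : G)).symm.trans
    (FaithfulSMul.algebraMap_injective _ _ h))
  simp at this
  exact hg this

/-- Equivariant specializations of the variables produce, from a stable subfield `E` of `K(S)`, a
stable subfield of `M` of at most the same transcendence degree on which no more elements
act trivially. -/
theorem exists_stable_subfield {K K' M : Type u} {S H : Type} [Field K] [Field K'] [Field M]
    [Algebra K K'] [Algebra K' M] [Algebra K M] [IsScalarTower K K' M] [Finite H]
    (π : H → Equiv.Perm S) (ρ : H → M ≃ₐ[K'] M)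
    (hM : ∀ Q : MvPolynomial S K, Q ≠ 0 →
      ∃ f : S → M, (∀ h s, f (π h s) = ρ h (f s)) ∧ aeval f Q ≠ 0)
    (E : IntermediateField K (FnField K S))
    (hE : ∀ h, ∀ x ∈ E, permGalAction K S (π h) x ∈ E) :
    ∃ E' : IntermediateField K' M, (∀ h, ∀ x ∈ E', ρ h x ∈ E') ∧
      (∀ h, (∃ x ∈ E, permGalAction K S (π h) x ≠ x) → ∃ x ∈ E', ρ h x ≠ x) ∧
      trdeg K' E' ≤ trdeg K E := by
  have hex : ∀ h, ∃ (a : FnField K S) (p q P : MvPolynomial S K), a ∈ E ∧ q ≠ 0 ∧ P ≠ 0 ∧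
      a * algebraMap _ _ q = algebraMap _ _ p ∧
      ((∃ x ∈ E, permGalAction K S (π h) x ≠ x) →
        P = rename (π h) p * q - p * rename (π h) q) := by
    intro h
    by_cases hh : ∃ x ∈ E, permGalAction K S (π h) x ≠ x
    · obtain ⟨a, haE, ha⟩ := hh
      obtain ⟨p, q, hq, hpq⟩ := IsFractionRing.div_surjective (A := MvPolynomial S K) a
      have hq0 : algebraMap _ (FnField K S) q ≠ 0 :=
        IsFractionRing.to_map_ne_zero_of_mem_nonZeroDivisors hq
      have hpq' : a * algebraMap _ _ q = algebraMap _ _ p := by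
        rw [← hpq, div_mul_cancel₀ _ hq0]
      refine ⟨a, p, q, _, haE, nonZeroDivisors.ne_zero hq, ?_, hpq', fun _ => rfl⟩
      intro h0
      have h1 := congrArg (permGalAction K S (π h)) hpq'
      rw [map_mul, permGalAction_algebraMap, permGalAction_algebraMap] at h1
      have h2 := congrArg (algebraMap _ (FnField K S)) h0
      rw [map_sub, map_mul, map_mul, map_zero, ← h1, ← hpq'] at h2
      have hq1 : algebraMap _ (FnField K S) (rename (π h) q) ≠ 0 := by
        rw [← permGalAction_algebraMap]
        simpa using hq0
      apply ha
      apply mul_right_cancel₀ (mul_ne_zero hq0 hq1)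
      linear_combination h2
    · exact ⟨0, 0, 1, 1, E.zero_mem, one_ne_zero, one_ne_zero, by simp, fun h => absurd h hh⟩
  choose a p q P haE hq hP hpq hPeq using hex
  have := Fintype.ofFinite H
  obtain ⟨f, hf, hfQ⟩ := hM (∏ h, q h * P h)
    (Finset.prod_ne_zero_iff.2 fun h _ => mul_ne_zero (hq h) (hP h))
  rw [map_prod] at hfQ
  have hfQ' : ∀ h, aeval f (q h) ≠ 0 ∧ aeval f (P h) ≠ 0 := fun h => by
    simpa [not_or] using Finset.prod_ne_zero_iff.1 hfQ h (Finset.mem_univ h)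
  have hren : ∀ h (Q : MvPolynomial S K), aeval f (rename (π h) Q) = ρ h (aeval f Q) := by
    intro h Q
    rw [aeval_rename]
    have : (f ∘ π h) = fun s => ((ρ h).restrictScalars K) (f s) := by ext s; exact hf h s
    rw [this]
    exact (DFunLike.congr_fun
      (comp_aeval f (((ρ h).restrictScalars K : M ≃ₐ[K] M) : M →ₐ[K] M)) Q).symm
  obtain ⟨A, ψ, hA, hA', hψ⟩ := exists_extension_of_algHom (aeval f : MvPolynomial S K →ₐ[K] M)
  have hstab : ∀ h (x : FnField K S) (hx : x ∈ A),
      ∃ hx' : permGalAction K S (π h) x ∈ A, ψ ⟨_, hx'⟩ = ρ h (ψ ⟨x, hx⟩) := by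
    intro h x hx
    obtain ⟨p, q, hq, hpq⟩ := hA' x hx
    have h1 := congrArg (permGalAction K S (π h)) hpq
    rw [map_mul, permGalAction_algebraMap, permGalAction_algebraMap] at h1
    have hq' : aeval f (rename (π h) q) ≠ 0 := by
      rw [hren]; simpa using hq
    refine ⟨hA _ _ _ hq' h1, ?_⟩
    have h2 := hψ ⟨_, hA _ _ _ hq' h1⟩ _ _ h1
    have h3 := congrArg (ρ h) (hψ ⟨x, hx⟩ _ _ hpq)
    rw [map_mul, ← hren, ← hren] at h3
    exact mul_right_cancel₀ hq' (h2.trans h3.symm)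
  set T : Set M := {y | ∃ (x : FnField K S) (hx : x ∈ A), x ∈ E ∧ ψ ⟨x, hx⟩ = y} with hT
  refine ⟨IntermediateField.adjoin K' T, ?_, ?_, ?_⟩
  · intro h x hx
    have : IntermediateField.adjoin K' T ≤
        (IntermediateField.adjoin K' T).comap (ρ h : M →ₐ[K'] M) := by
      rw [IntermediateField.adjoin_le_iff]
      rintro _ ⟨x, hxA, hxE, rfl⟩
      obtain ⟨hx', hx''⟩ := hstab h x hxA
      exact IntermediateField.subset_adjoin _ _ ⟨_, hx', hE h x hxE, hx''⟩
    exact this hx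
  · intro h hh
    have haA := hA _ _ _ (hfQ' h).1 (hpq h)
    refine ⟨ψ ⟨a h, haA⟩, IntermediateField.subset_adjoin _ _ ⟨_, haA, haE h, rfl⟩, fun h0 => ?_⟩
    apply (hfQ' h).2
    have h1 := hψ ⟨a h, haA⟩ _ _ (hpq h)
    have h2 := congrArg (ρ h) h1
    rw [map_mul, h0, ← hren, ← hren] at h2
    rw [hPeq h hh, map_sub, map_mul, map_mul, ← h1, ← h2]
    ring
  · refine trdeg_adjoin_le _ _ fun t ht hind => ?_
    choose r hrA hrE hr using ht
    have h1 := hind.restrictScalars (R := K) (algebraMap K K').injective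
    let ψ' : (E.toSubalgebra ⊓ A : Subalgebra K (FnField K S)) →ₐ[K] M :=
      ψ.comp (Subalgebra.inclusion inf_le_right)
    let r' : t → (E.toSubalgebra ⊓ A : Subalgebra K (FnField K S)) :=
      fun y => ⟨r y.2, hrE y.2, hrA y.2⟩
    have h2 : AlgebraicIndependent K r' := by
      apply AlgebraicIndependent.of_comp ψ'
      convert h1 using 1
      ext y
      exact hr y.2
    exact (h2.map' (f := (Subalgebra.inclusion inf_le_left :
      (E.toSubalgebra ⊓ A : Subalgebra K (FnField K S)) →ₐ[K] E.toSubalgebra))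
      (Subalgebra.inclusion_injective _)).cardinalMk_le_trdeg

theorem exists_equiv_prod_of_free {H S : Type*} [Group H] [Finite S] (π : H →* Equiv.Perm S)
    (hπ : ∀ h s, π h s = s → h = 1) :
    ∃ (m : ℕ) (e : H × Fin m ≃ S), ∀ g h i, e (g * h, i) = π g (e (h, i)) := by
  let _ : MulAction H S := MulAction.compHom S π
  let Ω := Quotient (MulAction.orbitRel H S)
  obtain ⟨m, ⟨v⟩⟩ := Finite.exists_equiv_fin Ω
  refine ⟨m, Equiv.ofBijective (fun p => π p.1 (v.symm p.2).out) ⟨?_, ?_⟩, ?_⟩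
  · rintro ⟨h, i⟩ ⟨h', i'⟩ heq
    have heq : h • (v.symm i).out = h' • (v.symm i').out := heq
    have h1 : v.symm i = v.symm i' := by
      rw [← Quotient.out_eq (v.symm i), ← Quotient.out_eq (v.symm i')]
      refine Quotient.sound (MulAction.orbitRel_apply.2 ⟨h⁻¹ * h', ?_⟩)
      change (h⁻¹ * h') • (v.symm i').out = _
      rw [mul_smul, ← heq, inv_smul_smul]
    have h2 := v.symm.injective h1
    subst h2
    have h3 : (h'⁻¹ * h) • (v.symm i).out = (v.symm i).out := by
      rw [mul_smul, heq, inv_smul_smul]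
    have h4 := hπ _ _ h3
    rw [inv_mul_eq_one] at h4
    rw [h4]
  · intro s
    have h1 : (⟦s⟧ : Ω).out ∈ MulAction.orbit H s :=
      MulAction.orbitRel_apply.1 (Quotient.exact (Quotient.out_eq (⟦s⟧ : Ω)))
    obtain ⟨h, hh⟩ := h1
    refine ⟨(h⁻¹, v ⟦s⟧), ?_⟩
    change h⁻¹ • (v.symm (v ⟦s⟧)).out = s
    rw [v.symm_apply_apply, ← hh]
    exact inv_smul_smul h s
  · intro g h i
    change π (g * h) _ = π g (π h _)
    rw [map_mul]
    rfl

theorem eq_of_sum_mul_pow_eq {m N : ℕ} (a b : Fin m → ℕ) (ha : ∀ i, a i < N) (hb : ∀ i, b i < N)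
    (h : ∑ i, a i * N ^ (i : ℕ) = ∑ i, b i * N ^ (i : ℕ)) : a = b := by
  have h1 : (fun i => (⟨a i, ha i⟩ : Fin N)) = fun i => ⟨b i, hb i⟩ := by
    apply finFunctionFinEquiv.injective
    ext
    simpa [finFunctionFinEquiv_apply] using h
  ext i
  exact congrArg Fin.val (congrFun h1 i)

/-- If `y` is an algebraically independent family of `H`-translates, then for a free finite
`H`-set `S` there are equivariant maps `S → M` which avoid all polynomials of bounded degree. -/
theorem exists_equivariant_aeval_ne_zero {K M : Type u} {S H : Type} [Field K] [Field M] [Algebra K M]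
    [Group H] [Finite H] [Finite S] (π : H →* Equiv.Perm S) (hπ : ∀ h s, π h s = s → h = 1)
    (ρ : H → M ≃ₐ[K] M) (y : H → M) (hy : AlgebraicIndependent K y)
    (hρ : ∀ h h', ρ h (y h') = y (h * h')) (N : ℕ) :
    ∃ f : S → M, (∀ h s, f (π h s) = ρ h (f s)) ∧
      ∀ Q : MvPolynomial S K, Q ≠ 0 → (∀ s, Q.degreeOf s < N) → aeval f Q ≠ 0 := by
  classical
  obtain ⟨m, e, he⟩ := exists_equiv_prod_of_free π hπ
  have := Fintype.ofFinite H
  have := Fintype.ofFinite S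
  refine ⟨fun s => y (e.symm s).1 ^ N ^ ((e.symm s).2 : ℕ), fun h s => ?_, fun Q hQ hdeg h0 => ?_⟩
  · obtain ⟨⟨h', i⟩, rfl⟩ := e.surjective s
    rw [← he]
    simp [hρ]
  · let g : S → MvPolynomial H K := fun s => X (e.symm s).1 ^ N ^ ((e.symm s).2 : ℕ)
    let E : (S →₀ ℕ) → (H →₀ ℕ) := fun d =>
      ∑ s, Finsupp.single (e.symm s).1 (d s * N ^ ((e.symm s).2 : ℕ))
    have h1 : aeval y (aeval g Q) = 0 := by
      rw [← h0, ← AlgHom.comp_apply, comp_aeval]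
      simp [g]
    have h2 : aeval g Q = 0 := hy (h1.trans (map_zero _).symm)
    have hE : ∀ d c, aeval g (monomial d c) = monomial (E d) c := by
      intro d c
      rw [aeval_monomial, Finsupp.prod_fintype _ _ (by simp)]
      simp only [E, g, MvPolynomial.algebraMap_eq]
      rw [← mul_one (C c), mul_assoc, one_mul]
      conv_rhs => rw [← mul_one c, ← C_mul_monomial]
      congr 1
      rw [monomial_sum_one]
      refine Finset.prod_congr rfl fun s _ => ?_
      rw [← pow_mul, X_pow_eq_monomial, mul_comm]
    have hinj : ∀ d d' : S →₀ ℕ, (∀ s, d s < N) → (∀ s, d' s < N) → E d = E d' → d = d' := by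
      intro d d' hd hd' hdd
      have hval : ∀ (d : S →₀ ℕ) h, E d h = ∑ i, d (e (h, i)) * N ^ (i : ℕ) := by
        intro d h
        simp only [E]
        rw [← e.sum_comp, Fintype.sum_prod_type, Finsupp.finsetSum_apply,
          Finset.sum_eq_single h]
        · simp
        · intro h' _ hh
          simp [hh]
        · simp
      ext s
      obtain ⟨⟨h, i⟩, rfl⟩ := e.surjective s
      refine congrFun (eq_of_sum_mul_pow_eq (N := N) (fun i => d (e (h, i)))
        (fun i => d' (e (h, i))) (fun _ => hd _) (fun _ => hd' _) ?_) i
      rw [← hval, ← hval, hdd]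
    obtain ⟨d, hd⟩ := MvPolynomial.ne_zero_iff.1 hQ
    have hlt : ∀ d ∈ Q.support, ∀ s, d s < N := fun d hd s =>
      (le_degreeOf_of_mem_support s hd).trans_lt (hdeg s)
    have h3 : aeval g Q = ∑ d ∈ Q.support, monomial (E d) (coeff d Q) := by
      conv_lhs => rw [Q.as_sum, map_sum]
      exact Finset.sum_congr rfl fun d _ => hE _ _
    have h4 := congrArg (coeff (E d)) (h3.symm.trans h2)
    rw [coeff_sum, Finset.sum_eq_single d] at h4
    · rw [coeff_monomial, if_pos rfl] at h4
      exact hd (by simpa using h4)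
    · intro d' hd' hne
      rw [coeff_monomial, if_neg]
      intro h
      exact hne (hinj _ _ (hlt _ hd') (hlt _ (mem_support_iff.2 hd)) h)
    · intro h
      exact absurd (mem_support_iff.2 hd) h

theorem algebraicIndependent_X_fnField (K S : Type*) [Field K] :
    AlgebraicIndependent K (fun s : S => algebraMap _ (FnField K S) (X s : MvPolynomial S K)) :=
  (MvPolynomial.algebraicIndependent_X S K).map'
    (f := IsScalarTower.toAlgHom K (MvPolynomial S K) (FnField K S))
    (FaithfulSMul.algebraMap_injective _ _)

theorem galAction_X {K G : Type*} [Field K] [Group G] (g h : G) :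
    galAction K G g (algebraMap _ _ (X h : MvPolynomial G K)) =
      algebraMap _ _ (X (g * h) : MvPolynomial G K) := by
  rw [galAction_apply, permGalAction_algebraMap, rename_X]
  rfl

/-- The essential dimension of `H` is bounded by the transcendence degree of any stable subfield
of the function field of a free `H`-set on which `H` acts faithfully. -/
theorem edK_le_of_free {K : Type u} {S H : Type} [Field K] [Group H] [Finite H] [Finite S]
    (π : H →* Equiv.Perm S) (hπ : ∀ h s, π h s = s → h = 1)
    (E : IntermediateField K (FnField K S))
    (h₁ : ∀ h : H, ∀ x ∈ E, permGalAction K S (π h) x ∈ E)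
    (h₂ : ∀ h : H, h ≠ 1 → ∃ x ∈ E, permGalAction K S (π h) x ≠ x) {d : ℕ}
    (hd : trdeg K E ≤ d) : edK K H ≤ d := by
  obtain ⟨E', h₁', h₂', hd'⟩ := exists_stable_subfield (K := K) (K' := K) (M := FnField K H)
    π (galAction K H) (fun Q hQ => by
      obtain ⟨f, hf, hfQ⟩ := exists_equivariant_aeval_ne_zero π hπ (galAction K H) _
        (algebraicIndependent_X_fnField K H) galAction_X (Q.totalDegree + 1)
      exact ⟨f, hf, hfQ Q hQ fun s => Nat.lt_succ_of_le (degreeOf_le_totalDegree Q s)⟩) E h₁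
  exact edK_le_of E' h₁' (fun h hh => h₂' h (h₂ h hh)) (hd'.trans hd)

theorem edK_le_of_injective (K : Type u) {G H : Type} [Field K] [Group G] [Finite G] [Group H]
    (φ : H →* G) (hφ : Function.Injective φ) : edK K H ≤ edK K G := by
  have := Finite.of_injective φ hφ
  obtain ⟨E, h₁, h₂, hd⟩ := exists_trdeg_eq_edK K G
  refine edK_le_of_free ((MulAction.toPermHom G G).comp φ) ?_ E (fun h => h₁ (φ h))
    (fun h hh => h₂ (φ h) ?_) hd.le
  · intro h s hs
    have : φ h * s = s := hs
    rw [mul_eq_right] at this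
    exact hφ (this.trans (map_one φ).symm)
  · exact fun h' => hh (hφ (h'.trans (map_one φ).symm))

theorem edK_le_of_algebra (K K' : Type u) (G : Type) [Field K] [Field K'] [Algebra K K'] [Group G]
    [Finite G] : edK K' G ≤ edK K G := by
  obtain ⟨E, h₁, h₂, hd⟩ := exists_trdeg_eq_edK K G
  obtain ⟨E', h₁', h₂', hd'⟩ := exists_stable_subfield (K := K) (K' := K') (M := FnField K' G)
    (MulAction.toPermHom G G) (galAction K' G) (fun Q hQ => by
      refine ⟨fun g => algebraMap _ _ (X g : MvPolynomial G K'), fun g h => (galAction_X g h).symm,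
        fun h0 => ?_⟩
      have h1 := (algebraicIndependent_X_fnField K' G).restrictScalars (R := K)
        (algebraMap K K').injective
      exact hQ (h1 (h0.trans (map_zero _).symm))) E h₁
  exact edK_le_of E' h₁' (fun h hh => h₂' h (h₂ h hh)) (hd'.trans hd.le)

section Laurent

variable {K F : Type*} [Field K] [Field F] [Algebra K F]

/-- The coefficientwise algebra structure, preferred to the one coming from power series. -/
instance laurentSeriesAlgebra : Algebra K (HahnSeries ℤ F) := HahnSeries.instAlgebra

theorem coeff_algebraMap_laurentSeries (k : K) (n : ℤ) :
    (algebraMap K (HahnSeries ℤ F) k).coeff n = if n = 0 then algebraMap K F k else 0 := by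
  refine (congrArg (HahnSeries.coeff · n) (HahnSeries.algebraMap_apply (Γ := ℤ) (r := k))).trans ?_
  split_ifs with hn
  · simp [hn]
  · simp [HahnSeries.C_apply, HahnSeries.coeff_single_of_ne hn]

/-- The underlying function of `laurentTwistHom`. -/
def laurentTwistFun (σ : F ≃ₐ[K] F) (u : Kˣ) (x : HahnSeries ℤ F) : HahnSeries ℤ F where
  coeff n := ((u ^ n : Kˣ) : K) • σ (x.coeff n)
  isPWO_support' := x.isPWO_support.mono fun n hn =>
    (HahnSeries.mem_support _ _).2 fun hx => hn (by simp [hx])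

theorem coeff_laurentTwistFun (σ : F ≃ₐ[K] F) (u : Kˣ) (x : HahnSeries ℤ F) (n : ℤ) :
    (laurentTwistFun σ u x).coeff n = ((u ^ n : Kˣ) : K) • σ (x.coeff n) := rfl

theorem support_laurentTwistFun (σ : F ≃ₐ[K] F) (u : Kˣ) (x : HahnSeries ℤ F) :
    (laurentTwistFun σ u x).support = x.support := by
  ext n
  rw [HahnSeries.mem_support, HahnSeries.mem_support, coeff_laurentTwistFun, Ne, Ne,
    smul_eq_zero, or_iff_right (Units.ne_zero _), map_eq_zero]

/-- The endomorphism `∑ aₙ tⁿ ↦ ∑ σ(aₙ) (u t)ⁿ` of the field of Laurent series. -/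
def laurentTwistHom (σ : F ≃ₐ[K] F) (u : Kˣ) : HahnSeries ℤ F →ₐ[K] HahnSeries ℤ F where
  toFun := laurentTwistFun σ u
  map_one' := by
    ext n
    rw [coeff_laurentTwistFun, HahnSeries.coeff_one]
    split_ifs with hn
    · simp [hn]
    · simp
  map_mul' x y := by
    ext n
    rw [HahnSeries.coeff_mul, coeff_laurentTwistFun, HahnSeries.coeff_mul, map_sum,
      Finset.smul_sum]
    refine Finset.sum_congr ?_ fun p hp => ?_
    · ext p
      simp only [Finset.mem_antidiagonal, support_laurentTwistFun]
    · obtain ⟨-, -, h⟩ := Finset.mem_antidiagonal.1 hp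
      rw [← h, zpow_add, map_mul, Units.val_mul, ← smul_mul_smul_comm, coeff_laurentTwistFun,
        coeff_laurentTwistFun]
  map_zero' := by ext; simp [coeff_laurentTwistFun]
  map_add' x y := by ext; simp [coeff_laurentTwistFun]
  commutes' k := by
    ext n
    rw [coeff_laurentTwistFun, coeff_algebraMap_laurentSeries]
    split_ifs with hn
    · simp [hn]
    · simp

@[simp]
theorem coeff_laurentTwistHom (σ : F ≃ₐ[K] F) (u : Kˣ) (x : HahnSeries ℤ F) (n : ℤ) :
    (laurentTwistHom σ u x).coeff n = ((u ^ n : Kˣ) : K) • σ (x.coeff n) := rfl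

theorem laurentTwistHom_comp (σ σ' : F ≃ₐ[K] F) (u u' : Kˣ) (x : HahnSeries ℤ F) :
    laurentTwistHom σ u (laurentTwistHom σ' u' x) = laurentTwistHom (σ * σ') (u * u') x := by
  ext n
  simp [mul_zpow, smul_smul]

theorem laurentTwistHom_one (x : HahnSeries ℤ F) :
    laurentTwistHom (1 : F ≃ₐ[K] F) (1 : Kˣ) x = x := by
  ext n
  simp

/-- `laurentTwistHom` as an algebra automorphism. -/
def laurentTwist (σ : F ≃ₐ[K] F) (u : Kˣ) : HahnSeries ℤ F ≃ₐ[K] HahnSeries ℤ F :=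
  AlgEquiv.ofAlgHom (laurentTwistHom σ u) (laurentTwistHom σ⁻¹ u⁻¹)
    (by ext1 x; simp only [AlgHom.comp_apply, laurentTwistHom_comp, mul_inv_cancel,
          laurentTwistHom_one, AlgHom.id_apply])
    (by ext1 x; simp only [AlgHom.comp_apply, laurentTwistHom_comp, inv_mul_cancel,
          laurentTwistHom_one, AlgHom.id_apply])

@[simp]
theorem coeff_laurentTwist (σ : F ≃ₐ[K] F) (u : Kˣ) (x : HahnSeries ℤ F) (n : ℤ) :
    (laurentTwist σ u x).coeff n = ((u ^ n : Kˣ) : K) • σ (x.coeff n) := rfl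

theorem laurentTwist_comp (σ σ' : F ≃ₐ[K] F) (u u' : Kˣ) (x : HahnSeries ℤ F) :
    laurentTwist σ u (laurentTwist σ' u' x) = laurentTwist (σ * σ') (u * u') x :=
  laurentTwistHom_comp σ σ' u u' x

theorem laurentTwist_one (x : HahnSeries ℤ F) :
    laurentTwist (1 : F ≃ₐ[K] F) (1 : Kˣ) x = x := laurentTwistHom_one x

theorem HahnSeries.order_inv_int {F : Type*} [Field F] {x : HahnSeries ℤ F} (hx : x ≠ 0) :
    x⁻¹.order = -x.order := by
  have := HahnSeries.order_mul hx (inv_ne_zero hx)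
  rw [mul_inv_cancel₀ hx, HahnSeries.order_one] at this
  omega

theorem HahnSeries.order_zpow_int {F : Type*} [Field F] {x : HahnSeries ℤ F} (hx : x ≠ 0)
    (n : ℤ) : (x ^ n).order = n * x.order := by
  obtain ⟨n, rfl | rfl⟩ := n.eq_nat_or_neg
  · simp
  · rw [zpow_neg, HahnSeries.order_inv_int (zpow_ne_zero _ hx)]
    simp

/-- The Laurent series without negative powers. -/
def laurentIntegers (K F : Type*) [Field K] [Field F] [Algebra K F] :
    Subalgebra K (HahnSeries ℤ F) where
  carrier := {x | ∀ n < 0, x.coeff n = 0}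
  mul_mem' {x y} hx hy n hn := by
    rw [HahnSeries.coeff_mul]
    refine Finset.sum_eq_zero fun p hp => ?_
    obtain ⟨-, -, h⟩ := Finset.mem_antidiagonal.1 hp
    by_cases h1 : p.1 < 0
    · rw [hx _ h1, zero_mul]
    · rw [hy _ (by omega), mul_zero]
  add_mem' {x y} hx hy n hn := by
    rw [HahnSeries.coeff_add, hx n hn, hy n hn, add_zero]
  algebraMap_mem' k n hn := by
    rw [coeff_algebraMap_laurentSeries, if_neg hn.ne]

theorem mem_laurentIntegers {x : HahnSeries ℤ F} :
    x ∈ laurentIntegers K F ↔ ∀ n < 0, x.coeff n = 0 := Iff.rfl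

theorem mem_laurentIntegers_of_order_nonneg {x : HahnSeries ℤ F} (hx : 0 ≤ x.order) :
    x ∈ laurentIntegers K F :=
  fun _ hn => HahnSeries.coeff_eq_zero_of_lt_order (hn.trans_le hx)

theorem order_nonneg_of_mem_laurentIntegers {x : HahnSeries ℤ F} (hx : x ∈ laurentIntegers K F) :
    0 ≤ x.order := by
  by_contra! h
  have := HahnSeries.coeff_order_eq_zero.1 (hx _ h)
  simp [this] at h

/-- The constant coefficient of a Laurent series without negative powers. -/
def laurentConstCoeff (K F : Type*) [Field K] [Field F] [Algebra K F] :
    laurentIntegers K F →ₐ[K] F where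
  toFun x := x.1.coeff 0
  map_one' := by simp
  map_mul' x y := by
    rw [Subalgebra.coe_mul, HahnSeries.coeff_mul]
    by_cases h : x.1.coeff 0 = 0 ∨ y.1.coeff 0 = 0
    · rw [mul_eq_zero.2 h]
      refine Finset.sum_eq_zero fun p hp => ?_
      obtain ⟨h1, h2, h3⟩ := Finset.mem_antidiagonal.1 hp
      have h1' : 0 ≤ p.1 := by
        by_contra! hlt
        exact h1 (x.2 _ hlt)
      have h2' : 0 ≤ p.2 := by
        by_contra! hlt
        exact h2 (y.2 _ hlt)
      rw [show p.1 = 0 by omega, show p.2 = 0 by omega]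
      exact mul_eq_zero.2 h
    · push Not at h
      refine Finset.sum_eq_single (0, 0) (fun p hp hne => ?_) fun hp => ?_
      · obtain ⟨-, -, h3⟩ := Finset.mem_antidiagonal.1 hp
        rcases lt_trichotomy p.1 0 with h1 | h1 | h1
        · rw [x.2 _ h1, zero_mul]
        · exact absurd (Prod.ext h1 (by simp; omega)) hne
        · rw [y.2 _ (by omega), mul_zero]
      · exact absurd (Finset.mem_antidiagonal.2 ⟨h.1, h.2, by simp⟩) hp
  map_zero' := by simp
  map_add' x y := by simp
  commutes' k := by
    change (algebraMap K (HahnSeries ℤ F) k).coeff 0 = _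
    rw [coeff_algebraMap_laurentSeries, if_pos rfl]

/-- The constant coefficient on the integral elements of a subfield of the Laurent series. -/
def residueHom (E : IntermediateField K (HahnSeries ℤ F)) :
    (E.toSubalgebra ⊓ laurentIntegers K F : Subalgebra K (HahnSeries ℤ F)) →ₐ[K] F :=
  (laurentConstCoeff K F).comp (Subalgebra.inclusion inf_le_right)

/-- The residue field of a subfield of the field of Laurent series. -/
def residueSubfield (E : IntermediateField K (HahnSeries ℤ F)) : IntermediateField K F :=
  (residueHom E).range.toIntermediateField (by
    rintro _ ⟨x, rfl⟩
    by_cases h : residueHom E x = 0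
    · refine ⟨0, ?_⟩
      change residueHom E 0 = (residueHom E x)⁻¹
      rw [h, map_zero, inv_zero]
    · have hx0 : x.1 ≠ 0 := by
        rintro h0
        rw [show x = 0 from Subtype.ext h0, map_zero] at h
        exact h rfl
      have h1 : x.1.order ≤ 0 := HahnSeries.order_le_of_coeff_ne_zero h
      have h2 := order_nonneg_of_mem_laurentIntegers x.2.2
      have h3 : x.1⁻¹ ∈ laurentIntegers K F := mem_laurentIntegers_of_order_nonneg (by
        rw [HahnSeries.order_inv_int hx0]; omega)
      refine ⟨⟨x.1⁻¹, E.inv_mem x.2.1, h3⟩, ?_⟩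
      apply eq_inv_of_mul_eq_one_left
      change residueHom E _ * residueHom E x = 1
      rw [← map_mul, ← map_one (residueHom E)]
      congr 1
      exact Subtype.ext (inv_mul_cancel₀ hx0))

theorem mem_residueSubfield {E : IntermediateField K (HahnSeries ℤ F)} {a : F} :
    a ∈ residueSubfield E ↔ ∃ x ∈ E, x ∈ laurentIntegers K F ∧ x.coeff 0 = a := by
  constructor
  · rintro ⟨x, rfl⟩
    exact ⟨x.1, x.2.1, x.2.2, rfl⟩
  · rintro ⟨x, h1, h2, rfl⟩
    exact ⟨⟨x, h1, h2⟩, rfl⟩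

end Laurent
theorem trdeg_residueSubfield_add_one_le {K F : Type u} [Field K] [Field F] [Algebra K F]
    (E : IntermediateField K (HahnSeries ℤ F)) {b : HahnSeries ℤ F} (hb : b ∈ E)
    (hb0 : b ≠ 0) (hord : b.order ≠ 0) : trdeg K (residueSubfield E) + 1 ≤ trdeg K E := by
  obtain ⟨b, hb, hb0, hord⟩ : ∃ b ∈ E, b ≠ 0 ∧ 0 < b.order := by
    rcases lt_or_gt_of_ne hord with h | h
    · exact ⟨b⁻¹, E.inv_mem hb, inv_ne_zero hb0, by rw [HahnSeries.order_inv_int hb0]; omega⟩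
    · exact ⟨b, hb, hb0, h⟩
  obtain ⟨t, ht⟩ := exists_isTranscendenceBasis K (residueSubfield E)
  have h1 := ht.1.map' (f := (residueSubfield E).val) (residueSubfield E).val.injective
  have hr : ∀ y : t, ∃ x, residueHom E x = y.1.1 := fun y => y.1.2
  choose r hr using hr
  have h2 : AlgebraicIndependent K (residueHom E ∘ r) := by
    convert h1 using 1
    ext y
    exact hr y
  let b' : (E.toSubalgebra ⊓ laurentIntegers K F : Subalgebra K (HahnSeries ℤ F)) :=
    ⟨b, hb, mem_laurentIntegers_of_order_nonneg hord.le⟩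
  have hb' : b' ≠ 0 := fun h => hb0 (congrArg Subtype.val h)
  have hb'' : residueHom E b' = 0 := HahnSeries.coeff_eq_zero_of_lt_order hord
  have h3 := AlgebraicIndependent.option_of_map_eq_zero _ r h2 b' hb' hb''
  let ι : (E.toSubalgebra ⊓ laurentIntegers K F : Subalgebra K (HahnSeries ℤ F)) →ₐ[K] E :=
    Subalgebra.inclusion inf_le_left
  have hι : Function.Injective ι := Subalgebra.inclusion_injective _
  have h4 := (h3.map' (f := ι) hι).cardinalMk_le_trdeg
  rw [Cardinal.mk_option, ht.cardinalMk_eq_trdeg] at h4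
  exact h4

/-- An automorphism of order three acting nontrivially on a subfield has an eigenvector with
eigenvalue a given primitive cube root of unity. -/
theorem exists_eigenvector_of_pow_three {K M : Type*} [Field K] [Field M] [Algebra K M] {ζ : K}
    (hζ : IsPrimitiveRoot ζ 3) (h3 : (3 : K) ≠ 0) (s : M ≃ₐ[K] M) (E : IntermediateField K M)
    (hs : ∀ x ∈ E, s x ∈ E) (hs3 : ∀ x ∈ E, s (s (s x)) = x) (hne : ∃ x ∈ E, s x ≠ x) :
    ∃ x ∈ E, x ≠ 0 ∧ s x = ζ • x := by
  obtain ⟨v, hv, hsv⟩ := hne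
  have hζ3 : ζ ^ 3 = 1 := hζ.pow_eq_one
  have hζsum : 1 + ζ + ζ ^ 2 = 0 := by
    have := hζ.geom_sum_eq_zero (by norm_num)
    simpa [Finset.sum_range_succ] using this
  have hv1 := hs v hv
  have hv2 := hs _ hv1
  have hv3 := hs3 v hv
  by_cases h1 : v + ζ ^ 2 • s v + ζ • s (s v) = 0
  · by_cases h2 : v + ζ • s v + ζ ^ 2 • s (s v) = 0
    · exfalso
      have h4 : (3 : K) • v = v + s v + s (s v) := by
        have h5 : (3 : K) • v = (v + s v + s (s v)) + (v + ζ ^ 2 • s v + ζ • s (s v)) +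
            (v + ζ • s v + ζ ^ 2 • s (s v)) - (1 + ζ + ζ ^ 2) • (s v + s (s v)) := by
          module
        rw [h5, h1, h2, hζsum]
        simp
      have h5 : (3 : K) • s v = (3 : K) • v := by
        rw [← map_smul, h4, map_add, map_add, hv3]
        ring
      exact hsv (smul_right_injective M h3 h5)
    · refine ⟨(v + ζ • s v + ζ ^ 2 • s (s v)) ^ 2, pow_mem
        (E.add_mem (E.add_mem hv (E.smul_mem hv1)) (E.smul_mem hv2)) 2, pow_ne_zero 2 h2, ?_⟩
      have h4 : s (v + ζ • s v + ζ ^ 2 • s (s v)) =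
          ζ ^ 2 • (v + ζ • s v + ζ ^ 2 • s (s v)) := by
        rw [map_add, map_add, map_smul, map_smul, hv3, smul_add, smul_add, smul_smul, smul_smul,
          ← pow_succ, ← pow_add, pow_succ ζ 3, hζ3]
        module
      rw [map_pow, h4, smul_pow, ← pow_mul, pow_succ ζ 3, hζ3, one_mul]
  · refine ⟨_, E.add_mem (E.add_mem hv (E.smul_mem hv1)) (E.smul_mem hv2), h1, ?_⟩
    rw [map_add, map_add, map_smul, map_smul, hv3, smul_add, smul_add, smul_smul, smul_smul,
      ← pow_succ', hζ3]
    module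

theorem coeff_zero_of_laurentTwist_eq {K F : Type*} [Field K] [Field F] [Algebra K F]
    {σ : F ≃ₐ[K] F} {u : Kˣ} {z : HahnSeries ℤ F} {k : K} (h : laurentTwist σ u z = k • z) :
    σ (z.coeff 0) = k • z.coeff 0 := by
  have := congrArg (HahnSeries.coeff · 0) h
  simp only [coeff_laurentTwist, zpow_zero, Units.val_one, one_smul] at this
  exact this

theorem zpow_order_eq_of_laurentTwist_eq {K F : Type*} [Field K] [Field F] [Algebra K F] {ζ : Kˣ}
    {y : HahnSeries ℤ F} (hy : y ≠ 0)
    (h : laurentTwist (1 : F ≃ₐ[K] F) ζ y = (ζ : K) • y) : ζ ^ y.order = ζ := by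
  have h : ((ζ ^ y.order : Kˣ) : K) • y.coeff y.order = (ζ : K) • y.coeff y.order :=
    congrArg (HahnSeries.coeff · y.order) h
  exact Units.ext (smul_left_injective K (mt HahnSeries.coeff_order_eq_zero.1 hy) h)

/-- If the group generated by an automorphism `σ` of order three and the rotation `t ↦ ζ t` acts
faithfully on a field of Laurent series, then `σ` acts nontrivially on its residue field. -/
theorem exists_mem_residueSubfield_ne {K F : Type*} [Field K] [Field F] [Algebra K F]
    {ζ : Kˣ} (hζ : IsPrimitiveRoot (ζ : K) 3) (h3 : (3 : K) ≠ 0) (σ : F ≃ₐ[K] F) (hσ : σ ^ 3 = 1)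
    (E : IntermediateField K (HahnSeries ℤ F))
    (hEσ : ∀ x ∈ E, laurentTwist σ (1 : Kˣ) x ∈ E)
    (hEζ : ∀ x ∈ E, laurentTwist (1 : F ≃ₐ[K] F) ζ x ∈ E)
    (hne : ∀ j : ℕ, ∃ x ∈ E, laurentTwist σ (ζ ^ j) x ≠ x)
    (hneζ : ∃ x ∈ E, laurentTwist (1 : F ≃ₐ[K] F) ζ x ≠ x) :
    ∃ a ∈ residueSubfield E, σ a ≠ a := by
  by_contra! htriv
  have hζ3 : ζ ^ 3 = 1 := Units.ext (by simpa using hζ.pow_eq_one)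
  have hstab : ∀ j : ℕ, ∀ x ∈ E, laurentTwist σ (ζ ^ j) x ∈ E := by
    intro j
    induction j with
    | zero => simpa using hEσ
    | succ j ih =>
      intro x hx
      have := hEζ _ (ih x hx)
      rwa [laurentTwist_comp, one_mul, ← pow_succ'] at this
  have hcube : ∀ (τ : F ≃ₐ[K] F) (u : Kˣ), τ ^ 3 = 1 → u ^ 3 = 1 → ∀ x : HahnSeries ℤ F,
      laurentTwist τ u (laurentTwist τ u (laurentTwist τ u x)) = x := by
    intro τ u hτ hu x
    rw [laurentTwist_comp, laurentTwist_comp, ← pow_three', ← pow_three', hτ,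
      hu, laurentTwist_one]
  obtain ⟨y₀, hy₀E, hy₀, hcy₀⟩ := exists_eigenvector_of_pow_three hζ h3 _ E hEζ
    (fun x _ => hcube _ _ (one_pow _) hζ3 x) hneζ
  have hcomm : ∀ x : HahnSeries ℤ F, laurentTwist (1 : F ≃ₐ[K] F) ζ (laurentTwist σ (1 : Kˣ) x) =
      laurentTwist σ (1 : Kˣ) (laurentTwist (1 : F ≃ₐ[K] F) ζ x) := by
    intro x
    rw [laurentTwist_comp, laurentTwist_comp, one_mul, mul_one, one_mul, mul_one]
  obtain ⟨y, i, hyE, hy, hcy, hτy⟩ : ∃ (y : HahnSeries ℤ F) (i : ℕ), y ∈ E ∧ y ≠ 0 ∧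
      laurentTwist (1 : F ≃ₐ[K] F) ζ y = (ζ : K) • y ∧
      laurentTwist σ (1 : Kˣ) y = ((ζ : K) ^ i) • y := by
    by_contra! hcon
    have hzero : ∀ i : ℕ, y₀ + ((ζ : K) ^ i) ^ 2 • laurentTwist σ (1 : Kˣ) y₀ +
        (ζ : K) ^ i • laurentTwist σ (1 : Kˣ) (laurentTwist σ (1 : Kˣ) y₀) = 0 := by
      intro i
      by_contra h0
      have hi : ((ζ : K) ^ i) ^ 3 = 1 := by
        rw [← pow_mul, mul_comm, pow_mul, hζ.pow_eq_one, one_pow]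
      refine hcon _ i (E.add_mem (E.add_mem hy₀E (E.smul_mem (hEσ _ hy₀E)))
        (E.smul_mem (hEσ _ (hEσ _ hy₀E)))) h0 ?_ ?_
      · rw [map_add, map_add, map_smul, map_smul, hcomm, hcomm, hcomm, hcy₀, map_smul, map_smul]
        module
      · rw [map_add, map_add, map_smul, map_smul, hcube _ _ hσ (one_pow 3), smul_add, smul_add,
          smul_smul, smul_smul, ← pow_succ', hi]
        module
    have h0 := hzero 0
    have h1 := hzero 1
    have h2 := hzero 2
    apply smul_ne_zero h3 hy₀
    have hsum : (1 : K) + ζ + ζ ^ 2 = 0 := by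
      have := hζ.geom_sum_eq_zero (by norm_num)
      simpa [Finset.sum_range_succ] using this
    have hsum' : (1 : K) + ζ ^ 2 + ζ ^ 4 = 0 := by
      linear_combination hsum + (ζ : K) * hζ.pow_eq_one
    generalize laurentTwist σ (1 : Kˣ) (laurentTwist σ (1 : Kˣ) y₀) = b at *
    generalize laurentTwist σ (1 : Kˣ) y₀ = a at *
    have h4 : (3 : K) • y₀ = (y₀ + ((ζ : K) ^ 0) ^ 2 • a + (ζ : K) ^ 0 • b) +
        (y₀ + ((ζ : K) ^ 1) ^ 2 • a + (ζ : K) ^ 1 • b) +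
        (y₀ + ((ζ : K) ^ 2) ^ 2 • a + (ζ : K) ^ 2 • b) -
        (1 + (ζ : K) ^ 2 + (ζ : K) ^ 4) • a - (1 + (ζ : K) + (ζ : K) ^ 2) • b := by
      module
    rw [h4, h0, h1, h2, hsum, hsum']
    simp
  have hord : ζ ^ y.order = ζ := zpow_order_eq_of_laurentTwist_eq hy hcy
  have hcy' : ∀ j : ℕ, laurentTwist (1 : F ≃ₐ[K] F) (ζ ^ j) y = ((ζ : K) ^ j) • y := by
    intro j
    induction j with
    | zero => simp [laurentTwist_one]
    | succ j ih =>
      rw [← one_mul (1 : F ≃ₐ[K] F), pow_succ, ← laurentTwist_comp, hcy, map_smul, ih, smul_smul,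
        pow_succ']
  have hτ'y : laurentTwist σ (ζ ^ (2 * i)) y = y := by
    rw [← one_mul (ζ ^ (2 * i)), ← mul_one σ, ← laurentTwist_comp, hcy', map_smul, hτy, smul_smul,
      ← pow_add, show 2 * i + i = 3 * i by ring, pow_mul, hζ.pow_eq_one, one_pow, one_smul]
  obtain ⟨x, hxE, hx, hτ'x⟩ := exists_eigenvector_of_pow_three hζ h3 _ E (hstab (2 * i))
    (fun x _ => hcube _ _ hσ (by rw [← pow_mul, mul_comm, pow_mul, hζ3, one_pow]) x) (hne (2 * i))
  set z := x ^ y.order * y ^ (-x.order) with hz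
  have hzE : z ∈ E := E.mul_mem (zpow_mem hxE _) (zpow_mem hyE _)
  have hz0 : z ≠ 0 := mul_ne_zero (zpow_ne_zero _ hx) (zpow_ne_zero _ hy)
  have hzord : z.order = 0 := by
    rw [hz, HahnSeries.order_mul (zpow_ne_zero _ hx) (zpow_ne_zero _ hy),
      HahnSeries.order_zpow_int hx, HahnSeries.order_zpow_int hy]
    ring
  have hτ'z : laurentTwist σ (ζ ^ (2 * i)) z = (ζ : K) • z := by
    rw [hz, map_mul, map_zpow₀, map_zpow₀, hτ'x, hτ'y, Algebra.smul_def, mul_zpow, ← map_zpow₀,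
      ← Units.val_zpow_eq_zpow_val, hord, mul_assoc, ← Algebra.smul_def]
  have h5 := coeff_zero_of_laurentTwist_eq hτ'z
  have hzc : z.coeff 0 ≠ 0 := by
    rw [← hzord]
    exact mt HahnSeries.coeff_order_eq_zero.1 hz0
  rw [htriv _ (mem_residueSubfield.2 ⟨z, hzE, mem_laurentIntegers_of_order_nonneg hzord.ge,
    rfl⟩)] at h5
  exact hζ.ne_one (by norm_num) (smul_left_injective K hzc (by simpa using h5.symm))

theorem laurentTwist_single {K F : Type*} [Field K] [Field F] [Algebra K F] (σ : F ≃ₐ[K] F)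
    (u : Kˣ) (n : ℤ) (a : F) : laurentTwist σ u (HahnSeries.single n a) =
      HahnSeries.single n (((u ^ n : Kˣ) : K) • σ a) := by
  ext m
  rw [coeff_laurentTwist]
  rcases eq_or_ne m n with rfl | h
  · simp
  · simp [HahnSeries.coeff_single_of_ne h]

/-- The inclusion of polynomials in Laurent series. -/
def polynomialToLaurent (K F : Type*) [Field K] [Field F] [Algebra K F] :
    Polynomial F →ₐ[K] HahnSeries ℤ F where
  __ := (HahnSeries.ofPowerSeries ℤ F).comp Polynomial.coeToPowerSeries.ringHom
  commutes' k := by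
    change HahnSeries.ofPowerSeries ℤ F ((Polynomial.C (algebraMap K F k) : Polynomial F) :
      PowerSeries F) = HahnSeries.C (algebraMap K F k)
    rw [Polynomial.coe_C, HahnSeries.ofPowerSeries_C]

theorem polynomialToLaurent_injective (K F : Type*) [Field K] [Field F] [Algebra K F] :
    Function.Injective (polynomialToLaurent K F) :=
  HahnSeries.ofPowerSeries_injective.comp (Polynomial.coe_injective F)

theorem polynomialToLaurent_C_mul_X_pow (K : Type*) {F : Type*} [Field K] [Field F] [Algebra K F]
    (a : F) (n : ℕ) :
    polynomialToLaurent K F (Polynomial.C a * Polynomial.X ^ n) = HahnSeries.single (n : ℤ) a := by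
  have hC : polynomialToLaurent K F (Polynomial.C a) = HahnSeries.single (0 : ℤ) a :=
    (congrArg (HahnSeries.ofPowerSeries ℤ F) (Polynomial.coe_C a)).trans
      (HahnSeries.ofPowerSeries_C a)
  have hX : polynomialToLaurent K F Polynomial.X = HahnSeries.single (1 : ℤ) 1 :=
    (congrArg (HahnSeries.ofPowerSeries ℤ F) Polynomial.coe_X).trans HahnSeries.ofPowerSeries_X
  rw [map_mul, map_pow, hC, hX, HahnSeries.single_pow, HahnSeries.single_mul_single, one_pow,
    mul_one, zero_add, nsmul_one]

/-- A family of Laurent series over `K(G)` translated by `G` and by the rotation `t ↦ ζ t`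
compatibly with the left translations by the centralizer of `c` and by `c`. -/
theorem exists_twisted_family {K : Type u} {G : Type} [Field K] [Group G] {ζ : Kˣ}
    (hζ : IsPrimitiveRoot (ζ : K) 3) (h3 : (3 : K) ≠ 0) (c : G) (hc : c ^ 3 = 1) :
    ∃ f : G → HahnSeries ℤ (FnField K G), AlgebraicIndependent K f ∧
      (∀ g, Commute g c → ∀ s, f (g * s) = laurentTwist (galAction K G g) (1 : Kˣ) (f s)) ∧
      (∀ s, f (c * s) = laurentTwist (1 : FnField K G ≃ₐ[K] FnField K G) ζ (f s)) := by
  have hζ3 : (ζ : K) ^ 3 = 1 := hζ.pow_eq_one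
  let x : G → FnField K G := fun s => algebraMap _ _ (X s : MvPolynomial G K)
  have hx : ∀ g s, galAction K G g (x s) = x (g * s) := galAction_X
  let A : K → G → FnField K G := fun w s =>
    (3 : K)⁻¹ • (x s + w ^ 2 • x (c * s) + w • x (c * (c * s)))
  let P : G → Polynomial (FnField K G) := fun s => ∑ i ∈ Finset.range 3,
    Polynomial.C (A ((ζ : K) ^ i) s) * Polynomial.X ^ i
  have hP : ∀ s, polynomialToLaurent K _ (P s) =
      ∑ i ∈ Finset.range 3, HahnSeries.single (i : ℤ) (A ((ζ : K) ^ i) s) := fun s => by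
    simp only [P, map_sum, polynomialToLaurent_C_mul_X_pow]
  refine ⟨fun s => polynomialToLaurent K _ (P s), ?_, ?_, ?_⟩
  · refine AlgebraicIndependent.map' (f := polynomialToLaurent K _) ?_
      (polynomialToLaurent_injective K _)
    refine AlgebraicIndependent.of_comp
      ((Polynomial.aeval (R := FnField K G) (1 : FnField K G)).restrictScalars K) ?_
    convert algebraicIndependent_X_fnField K G using 1
    ext s
    have hsum : (1 : K) + ζ + ζ ^ 2 = 0 := by
      have := hζ.geom_sum_eq_zero (by norm_num)
      simpa [Finset.sum_range_succ] using this
    have hsum' : (1 : K) + ζ ^ 2 + ζ ^ 4 = 0 := by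
      linear_combination hsum + (ζ : K) * hζ3
    have h4 : A ((ζ : K) ^ 0) s + A ((ζ : K) ^ 1) s + A ((ζ : K) ^ 2) s =
        (3 : K)⁻¹ • ((3 : K) • x s + ((1 : K) + ζ ^ 2 + ζ ^ 4) • x (c * s) +
          ((1 : K) + ζ + ζ ^ 2) • x (c * (c * s))) := by
      simp only [A]
      module
    rw [hsum, hsum', zero_smul, zero_smul, add_zero, add_zero, smul_smul, inv_mul_cancel₀ h3,
      one_smul] at h4
    simpa [P, Finset.sum_range_succ] using h4
  · intro g hg s
    simp only [hP, map_sum, laurentTwist_single]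
    refine Finset.sum_congr rfl fun i _ => ?_
    simp only [A, one_zpow, Units.val_one, one_smul, map_smul, map_add, hx]
    simp only [← mul_assoc, hg.eq]
    rw [mul_assoc c g c, hg.eq, ← mul_assoc]
  · intro s
    simp only [hP, map_sum, laurentTwist_single]
    refine Finset.sum_congr rfl fun i _ => ?_
    have hw : ((ζ : K) ^ i) ^ 3 = 1 := by
      rw [← pow_mul, mul_comm, pow_mul, hζ3, one_pow]
    have hu : ((ζ ^ (i : ℤ) : Kˣ) : K) = (ζ : K) ^ i := by simp
    have hcs : c * (c * (c * s)) = s := by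
      rw [← mul_assoc, ← mul_assoc, ← pow_three', hc, one_mul]
    rw [hu]
    generalize (ζ : K) ^ i = w at *
    simp only [A, AlgEquiv.one_apply, hcs]
    have hw' : w • (x s + w ^ 2 • x (c * s) + w • x (c * (c * s))) =
        x (c * s) + w ^ 2 • x (c * (c * s)) + w • x s := by
      rw [smul_add, smul_add, smul_smul, smul_smul, ← pow_succ', hw]
      module
    rw [smul_comm w, hw']

/-- If `G'` contains the product of `G` and a cyclic group of order three, and every nontrivial
normal subgroup of `G` contains an element of order three, then the essential dimension of `G'`
exceeds that of `G`. -/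
theorem edK_add_one_le_of_commute (K : Type u) {G G' : Type} [Field K] [Group G] [Group G']
    [Finite G] [Finite G'] {ζ : Kˣ} (hζ : IsPrimitiveRoot (ζ : K) 3) (h3 : (3 : K) ≠ 0)
    (j : G →* G') (c : G') (hc3 : c ^ 3 = 1) (hc : ∀ g, Commute (j g) c)
    (hj : ∀ g (k : ℕ), k < 3 → j g * c ^ k = 1 → g = 1 ∧ k = 0)
    (hG : ∀ N : Subgroup G, N.Normal → N ≠ ⊥ → ∃ τ ∈ N, τ ≠ 1 ∧ τ ^ 3 = 1) :
    edK K G + 1 ≤ edK K G' := by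
  have hζ3 : ζ ^ 3 = 1 := Units.ext (by simpa using hζ.pow_eq_one)
  obtain ⟨E₀, hE₀, hE₀f, hd₀⟩ := exists_trdeg_eq_edK K G'
  obtain ⟨f, hfind, hfg, hfc⟩ := exists_twisted_family hζ h3 c hc3
  have hfck : ∀ (k : ℕ) s, f (c ^ k * s) =
      laurentTwist (1 : FnField K G' ≃ₐ[K] FnField K G') (ζ ^ k) (f s) := by
    intro k s
    induction k with
    | zero => simp [laurentTwist_one]
    | succ k ih =>
      rw [pow_succ', mul_assoc, hfc, ih, laurentTwist_comp, one_mul, ← pow_succ']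
  obtain ⟨E, hE, hEf, hd⟩ := exists_stable_subfield (K := K) (K' := K)
    (M := HahnSeries ℤ (FnField K G')) (H := G × Fin 3)
    (fun h => MulAction.toPerm (j h.1 * c ^ (h.2 : ℕ)))
    (fun h => laurentTwist (galAction K G' (j h.1)) (ζ ^ (h.2 : ℕ)))
    (fun Q hQ => ⟨f, fun h s => by
      change f (j h.1 * c ^ (h.2 : ℕ) * s) = _
      rw [mul_assoc, hfg _ (hc _), hfck, laurentTwist_comp, mul_one, one_mul],
      fun h0 => hQ (hfind (h0.trans (map_zero _).symm))⟩) E₀ (fun h => hE₀ _)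
  have hEne : ∀ (g : G) (k : ℕ), (g ≠ 1 ∨ k % 3 ≠ 0) →
      ∃ x ∈ E, laurentTwist (galAction K G' (j g)) (ζ ^ k) x ≠ x := by
    intro g k hgk
    rw [pow_eq_pow_mod k hζ3]
    refine hEf (g, ⟨k % 3, Nat.mod_lt _ (by norm_num)⟩) (hE₀f _ fun h => ?_)
    obtain ⟨h1, h2⟩ := hj g (k % 3) (Nat.mod_lt _ (by norm_num)) h
    tauto
  have hEg : ∀ g : G, ∀ x ∈ E, laurentTwist (galAction K G' (j g)) (1 : Kˣ) x ∈ E := by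
    intro g x hx
    simpa using hE (g, 0) x hx
  have hEc : ∀ x ∈ E, laurentTwist (1 : FnField K G' ≃ₐ[K] FnField K G') ζ x ∈ E := by
    intro x hx
    simpa using hE (1, 1) x hx
  have hEcne : ∃ x ∈ E, laurentTwist (1 : FnField K G' ≃ₐ[K] FnField K G') ζ x ≠ x := by
    simpa using hEne 1 1 (Or.inr (by norm_num))
  obtain ⟨b, hbE, hb0, hcb⟩ := exists_eigenvector_of_pow_three hζ h3 _ E hEc (fun x _ => by
    rw [laurentTwist_comp, laurentTwist_comp, ← pow_three', ← pow_three', hζ3, one_pow,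
      laurentTwist_one]) hEcne
  have hbord : b.order ≠ 0 := fun h => by
    have := zpow_order_eq_of_laurentTwist_eq hb0 hcb
    rw [h, zpow_zero] at this
    rw [← this] at hζ
    exact hζ.ne_one (by norm_num) (by simp)
  have htr := (trdeg_residueSubfield_add_one_le E hbE hb0 hbord).trans (hd.trans hd₀.le)
  have hRstab : ∀ g : G, ∀ x ∈ residueSubfield E, galAction K G' (j g) x ∈ residueSubfield E := by
    intro g a ha
    obtain ⟨x, hxE, hxO, rfl⟩ := mem_residueSubfield.1 ha
    refine mem_residueSubfield.2 ⟨_, hEg g x hxE, fun n hn => ?_, ?_⟩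
    · rw [coeff_laurentTwist, hxO n hn]
      simp
    · simp
  let N : Subgroup G :=
    { carrier := {g | ∀ a ∈ residueSubfield E, galAction K G' (j g) a = a}
      mul_mem' := fun {g h} hg hh a ha => by
        rw [map_mul, map_mul, AlgEquiv.mul_apply, hh a ha, hg a ha]
      one_mem' := fun a _ => by simp
      inv_mem' := fun {g} hg a ha => by
        conv_lhs => rw [← hg a ha]
        rw [← AlgEquiv.mul_apply, ← map_mul, ← map_mul, inv_mul_cancel]
        simp }
  have hN : N.Normal := ⟨fun g hg h a ha => by
    rw [map_mul, map_mul, map_mul, map_mul, AlgEquiv.mul_apply, AlgEquiv.mul_apply,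
      hg _ (hRstab h⁻¹ a ha), ← AlgEquiv.mul_apply, ← map_mul, ← map_mul, mul_inv_cancel]
    simp⟩
  have hNbot : N = ⊥ := by
    by_contra hne
    obtain ⟨τ, hτN, hτ1, hτ3⟩ := hG N hN hne
    obtain ⟨a, ha, hτa⟩ := exists_mem_residueSubfield_ne hζ h3 (galAction K G' (j τ))
      (by rw [← map_pow, ← map_pow, hτ3, map_one, map_one]) E (hEg τ) hEc
      (fun k => hEne τ k (Or.inl hτ1)) hEcne
    exact hτa (hτN a ha)
  obtain ⟨m, hm⟩ := Cardinal.lt_aleph0.1 ((self_le_add_right _ _).trans_lt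
    (htr.trans_lt Cardinal.natCast_lt_aleph0))
  have hjinj : Function.Injective j := (injective_iff_map_eq_one j).2 fun g hg =>
    (hj g 0 (by norm_num) (by simpa using hg)).1
  have hle : edK K G ≤ m := edK_le_of_free ((MulAction.toPermHom G' G').comp j)
    (fun h s hs => hjinj ((mul_eq_right.1 (hs : j h * s = s)).trans (map_one j).symm))
    (residueSubfield E) hRstab (fun h hh => by
      by_contra! hcon
      have : h ∈ N := hcon
      rw [hNbot] at this
      exact hh this) hm.le
  rw [hm] at htr
  exact (Nat.succ_le_succ hle).trans (by exact_mod_cast htr)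

theorem edK_perm_add_one_le (K : Type u) [Field K] {ζ : K} (hζ : IsPrimitiveRoot ζ 3)
    (h3 : (3 : K) ≠ 0) (n : ℕ) (hn : n = 1 ∨ n = 3 ∨ 5 ≤ n) :
    edK K (Equiv.Perm (Fin n)) + 1 ≤ edK K (Equiv.Perm (Fin (n + 3))) := by
  let ζ' : Kˣ := hζ.isUnit (by norm_num) |>.unit
  let J : Equiv.Perm (Fin n) × Equiv.Perm (Fin 3) →* Equiv.Perm (Fin (n + 3)) :=
    (finSumFinEquiv.permCongrHom.toMonoidHom).comp (Equiv.Perm.sumCongrHom (Fin n) (Fin 3))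
  have hJ : Function.Injective J :=
    finSumFinEquiv.permCongrHom.injective.comp Equiv.Perm.sumCongrHom_injective
  refine edK_add_one_le_of_commute K (ζ := ζ') (by simpa [ζ'] using hζ) h3
    (J.comp (MonoidHom.inl _ _)) (J (1, finRotate 3)) ?_ ?_ ?_ ?_
  · rw [← map_pow, Prod.pow_mk, one_pow, show finRotate 3 ^ 3 = 1 by decide]
    exact map_one J
  · intro g
    change J (g, 1) * J (1, finRotate 3) = J (1, finRotate 3) * J (g, 1)
    rw [← map_mul, ← map_mul, Prod.mk_mul_mk, Prod.mk_mul_mk, one_mul, one_mul, mul_one, mul_one]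
  · intro g k hk h
    have h1 : J (g, finRotate 3 ^ k) = 1 := by
      rw [← h]
      change _ = J (g, 1) * J (1, finRotate 3) ^ k
      rw [← map_pow, ← map_mul, Prod.pow_mk, Prod.mk_mul_mk, one_mul, one_pow, mul_one]
    have h2 := Prod.ext_iff.1 (hJ (h1.trans (map_one J).symm))
    refine ⟨h2.1, ?_⟩
    have h3 := h2.2
    clear * - hk h3
    revert h3
    simp only [Prod.snd_one]
    decide +revert
  · intro N hN hne
    have hnt : Nontrivial N := (Subgroup.nontrivial_iff_ne_bot N).2 hne
    obtain ⟨g, hg⟩ := exists_ne (1 : N)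
    have hg1 : (g : Equiv.Perm (Fin n)) ≠ 1 := fun h => hg (Subtype.ext h)
    rcases hn with rfl | rfl | hn
    · exact absurd (Subsingleton.elim _ _) hg1
    · have key : ∀ g : Equiv.Perm (Fin 3), g ≠ 1 →
          ∃ h, g * (h * g⁻¹ * h⁻¹) ≠ 1 ∧ (g * (h * g⁻¹ * h⁻¹)) ^ 3 = 1 := by
        set_option maxRecDepth 10000 in decide
      obtain ⟨h, h1, h3⟩ := key g hg1
      exact ⟨_, N.mul_mem g.2 (hN.conj_mem _ (N.inv_mem g.2) h), h1, h3⟩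
    · have hA := Equiv.Perm.alternatingGroup_le_of_normal (by simpa using hn) hnt
      obtain ⟨τ, hτ⟩ : ∃ τ : Equiv.Perm (Fin n), τ.IsThreeCycle :=
        ⟨_, Equiv.Perm.isThreeCycle_swap_mul_swap_same (a := (⟨0, by omega⟩ : Fin n))
          (b := ⟨1, by omega⟩) (c := ⟨2, by omega⟩) (by simp [Fin.ext_iff])
          (by simp [Fin.ext_iff]) (by simp [Fin.ext_iff])⟩
      refine ⟨τ, hA hτ.mem_alternatingGroup, fun h => ?_, ?_⟩
      · have := hτ.orderOf
        simp [h] at this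
      · rw [← hτ.orderOf, pow_orderOf_eq_one]

/-- The image `y` of `x` under the fractional linear transformation with matrix `α A + β`, where
`A` has the entries `a`, `b`, `c`, `d`. -/
def IsPencilImage {K L : Type*} [Field K] [Field L] [Algebra K L] (a b c d : K) (x y : L)
    (α β : K) : Prop :=
  y * (algebraMap K L α * (algebraMap K L c * x + algebraMap K L d) + algebraMap K L β) =
    algebraMap K L α * (algebraMap K L a * x + algebraMap K L b) + algebraMap K L β * x

theorem IsPencilImage.comp {K L : Type*} [Field K] [Field L] [Algebra K L] {a b c d : K} {x y : L}
    {α β α' β' : K} (s : L →ₐ[K] L) (h : IsPencilImage a b c d x y α β)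
    (h' : IsPencilImage a b c d x (s x) α' β') :
    IsPencilImage a b c d x (s y) (α * α' * (a + d) + α * β' + β * α')
      (α * α' * (b * c - a * d) + β * β') := by
  have h1 := congrArg s h
  unfold IsPencilImage at h' ⊢
  simp only [map_mul, map_add, map_sub, AlgHom.commutes] at h1 ⊢
  linear_combination (algebraMap K L α' * (algebraMap K L c * x + algebraMap K L d) +
    algebraMap K L β') * h1 + (algebraMap K L α * algebraMap K L a + algebraMap K L β -
      s y * (algebraMap K L α * algebraMap K L c)) * h'

theorem IsPencilImage.eq_zero_or_eq {K L : Type*} [Field K] [Field L] [Algebra K L] {a b c d : K}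
    {x : L} (hx : Transcendental K x) {α β : K} (h : IsPencilImage a b c d x x α β) :
    α = 0 ∨ (a = d ∧ b = 0 ∧ c = 0) := by
  by_cases hα : α = 0
  · exact Or.inl hα
  have h0 : Polynomial.aeval x (Polynomial.C c * Polynomial.X ^ 2 +
      Polynomial.C (d - a) * Polynomial.X - Polynomial.C b) = 0 := by
    have hα' : algebraMap K L α ≠ 0 := (map_ne_zero _).2 hα
    apply mul_left_cancel₀ hα'
    unfold IsPencilImage at h
    simp only [map_sub, map_add, map_mul, Polynomial.aeval_C, Polynomial.aeval_X, map_pow]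
    linear_combination h
  have h1 := transcendental_iff.1 hx _ h0
  have hc := congrArg (Polynomial.coeff · 2) h1
  have hb := congrArg (Polynomial.coeff · 0) h1
  have hd := congrArg (Polynomial.coeff · 1) h1
  simp [Polynomial.coeff_X, Polynomial.coeff_C] at hc hb hd
  exact Or.inr ⟨(sub_eq_zero.1 hd).symm, hb, hc⟩

/-- In characteristic two, the projective linear group of rank two has no elements of order
six. -/
theorem pow_two_eq_one_or_pow_three_eq_one_of_pow_six {K L : Type*} [Field K] [CharP K 2] [Field L]
    [Algebra K L] {x : L} (hx : Transcendental K x) {a b c d : K} (hdet : b * c - a * d ≠ 0)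
    (s : L →ₐ[K] L) (hs : IsPencilImage a b c d x (s x) 1 0) (h6 : (s ^ 6) x = x) :
    (s ^ 2) x = x ∨ (s ^ 3) x = x := by
  have h2 := hs.comp s hs
  have h3 := h2.comp s hs
  have e2 : s (s x) = (s ^ 2) x := rfl
  have e3 : s ((s ^ 2) x) = (s ^ 3) x := rfl
  have e6 : (s ^ 3) ((s ^ 3) x) = (s ^ 6) x := rfl
  rw [e2] at h2 h3
  rw [e3] at h3
  have h66 := h3.comp (s ^ 3) h3
  rw [e6, h6] at h66
  have h20 : (2 : K) = 0 := CharTwo.two_eq_zero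
  set T := a + d with hT
  set D := b * c - a * d with hD
  have key : ∀ (y : L) (β : K), β ≠ 0 → IsPencilImage a b c d x y 0 β → y = x := by
    intro y β hβ hy
    unfold IsPencilImage at hy
    have hβ' : algebraMap K L β ≠ 0 := (map_ne_zero _).2 hβ
    rw [map_zero, zero_mul, zero_mul, zero_add, zero_add, mul_comm] at hy
    exact mul_left_cancel₀ hβ' hy
  rcases h66.eq_zero_or_eq hx with h0 | ⟨h0, hb, hc⟩
  · have h0' : (T ^ 2 + D) ^ 2 * T = 0 := by
      linear_combination h0 - (T ^ 2 + D) * (T * D) * h20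
    rcases mul_eq_zero.1 h0' with h0' | h0'
    · right
      have h0'' : T ^ 2 + D = 0 := by simpa using h0'
      have hT0 : T ≠ 0 := by
        rintro hT0
        rw [hT0] at h0''
        exact hdet (by simpa using h0'')
      refine key _ (T * D) (mul_ne_zero hT0 hdet) ?_
      convert h3 using 1
      · linear_combination -h0''
      · ring
    · left
      refine key _ D hdet ?_
      convert h2 using 1
      · linear_combination -h0'
      · ring
  · left
    have hT0 : T = 0 := by rw [hT, h0]; linear_combination d * h20
    refine key _ D hdet ?_
    convert h2 using 1
    · linear_combination -hT0
    · ring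

theorem RatFunc.pow_two_eq_one_or_pow_three_eq_one {K : Type*} [Field K] [CharP K 2]
    (s : RatFunc K →ₐ[K] RatFunc K) (h6 : s ^ 6 = 1) : s ^ 2 = 1 ∨ s ^ 3 = 1 := by
  have hsurj : Function.Surjective s := fun x => ⟨(s ^ 5) x, by
    rw [← AlgHom.mul_apply, ← pow_succ', h6, AlgHom.one_apply]⟩
  have htop : IntermediateField.adjoin K {s RatFunc.X} = ⊤ := by
    rw [← Set.image_singleton, ← IntermediateField.adjoin_map, RatFunc.adjoin_X,
      ← AlgHom.fieldRange_eq_map, AlgHom.fieldRange_eq_top.2 hsurj]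
  have hdeg := (s RatFunc.X).finrank_eq_max_natDegree
  rw [htop, IntermediateField.finrank_top] at hdeg
  obtain ⟨a, b, hab⟩ := Polynomial.exists_eq_X_add_C_of_natDegree_le_one
    ((le_max_left _ _).trans hdeg.ge)
  obtain ⟨c, d, hcd⟩ := Polynomial.exists_eq_X_add_C_of_natDegree_le_one
    ((le_max_right _ _).trans hdeg.ge)
  have h1 := RatFunc.num_div_denom (s RatFunc.X)
  have h2 : algebraMap (Polynomial K) (RatFunc K) (s RatFunc.X).denom ≠ 0 :=
    RatFunc.algebraMap_ne_zero (RatFunc.denom_ne_zero _)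
  rw [div_eq_iff h2, hab, hcd] at h1
  rw [hcd] at h2
  simp only [map_add, map_mul, RatFunc.algebraMap_C, RatFunc.algebraMap_X,
    ← RatFunc.algebraMap_eq_C] at h1 h2
  have hrel : IsPencilImage a b c d (RatFunc.X : RatFunc K) (s RatFunc.X) 1 0 := by
    unfold IsPencilImage
    simpa using h1.symm
  have hconst : ∀ k, s RatFunc.X ≠ algebraMap K (RatFunc K) k := by
    intro k hk
    rw [← AlgHom.commutes s k] at hk
    exact RatFunc.transcendental_X (s.injective hk ▸ isAlgebraic_algebraMap k)
  have hdet : b * c - a * d ≠ 0 := by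
    intro hdet
    have hdet' := congrArg (algebraMap K (RatFunc K)) hdet
    simp only [map_sub, map_mul, map_zero] at hdet'
    have hc : algebraMap K (RatFunc K) c * s RatFunc.X = algebraMap K (RatFunc K) a :=
      mul_left_cancel₀ h2 (by linear_combination -algebraMap K (RatFunc K) c * h1 + hdet')
    have hd : algebraMap K (RatFunc K) d * s RatFunc.X = algebraMap K (RatFunc K) b :=
      mul_left_cancel₀ h2 (by
        linear_combination -algebraMap K (RatFunc K) d * h1 - RatFunc.X * hdet')
    have hcd0 : c ≠ 0 ∨ d ≠ 0 := by
      by_contra! h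
      simp [h.1, h.2] at h2
    rcases hcd0 with h0 | h0
    · refine hconst (a / c) ?_
      rw [map_div₀, ← hc, mul_div_cancel_left₀ _ ((map_ne_zero _).2 h0)]
    · refine hconst (b / d) ?_
      rw [map_div₀, ← hd, mul_div_cancel_left₀ _ ((map_ne_zero _).2 h0)]
  have hext : ∀ k, (s ^ k) RatFunc.X = (RatFunc.X : RatFunc K) → s ^ k = 1 := by
    intro k hk
    ext y
    have hy : y ∈ IntermediateField.adjoin K {(RatFunc.X : RatFunc K)} := by
      rw [RatFunc.adjoin_X]
      trivial
    rw [AlgHom.one_apply]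
    induction hy using IntermediateField.adjoin_induction with
    | mem x hx => rw [Set.mem_singleton_iff.1 hx, hk]
    | algebraMap x => exact AlgHom.commutes _ _
    | add x y _ _ hx hy => rw [map_add, hx, hy]
    | inv x _ hx => rw [map_inv₀, hx]
    | mul x y _ _ hx hy => rw [map_mul, hx, hy]
  exact (pow_two_eq_one_or_pow_three_eq_one_of_pow_six RatFunc.transcendental_X hdet s hrel
    (by rw [h6]; rfl)).imp (hext 2) (hext 3)

theorem pow_two_eq_one_or_pow_three_eq_one_of_algHom_ratFunc {K L : Type*} [Field K] [CharP K 2]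
    [Field L] [Algebra K L] (θ : L →ₐ[K] RatFunc K) (s : L →ₐ[K] L) (h6 : s ^ 6 = 1) :
    s ^ 2 = 1 ∨ s ^ 3 = 1 := by
  by_cases hθ : θ.fieldRange = ⊥
  · left
    ext x
    have hx : θ x ∈ θ.fieldRange := ⟨x, rfl⟩
    rw [hθ] at hx
    obtain ⟨k, hk⟩ := IntermediateField.mem_bot.1 hx
    rw [← AlgHom.commutes θ k] at hk
    rw [← θ.injective hk]
    simp
  · let e : RatFunc K ≃ₐ[K] L :=
      (RatFunc.Luroth.algEquiv hθ).trans (AlgEquiv.ofInjectiveField θ).symm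
    let s' : RatFunc K →ₐ[K] RatFunc K := (e.symm : L →ₐ[K] RatFunc K).comp (s.comp e)
    have hs' : ∀ k y, e ((s' ^ k) y) = (s ^ k) (e y) := by
      intro k
      induction k with
      | zero => simp
      | succ k ih =>
        intro y
        rw [pow_succ, AlgHom.mul_apply, ih, pow_succ, AlgHom.mul_apply]
        simp [s']
    have hiff : ∀ k, s' ^ k = 1 ↔ s ^ k = 1 := by
      intro k
      constructor
      · intro h
        ext x
        obtain ⟨y, rfl⟩ := e.surjective x
        rw [← hs', h]
        rfl
      · intro h
        ext y
        apply e.injective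
        rw [hs', h]
        rfl
    exact (RatFunc.pow_two_eq_one_or_pow_three_eq_one s' ((hiff 6).2 h6)).imp (hiff 2).1 (hiff 3).1

/-- A finitely generated subfield of a field of transcendence degree at most one inside a rational
function field embeds in the field of rational functions of one variable. -/
theorem exists_algHom_ratFunc {K : Type u} {S : Type} [Field K] [Finite S]
    (E : IntermediateField K (FnField K S)) (hE : trdeg K E ≤ 1) (W : Set (FnField K S))
    (hW : W.Finite) (hWE : W ⊆ E) :
    Nonempty (IntermediateField.adjoin K W →ₐ[K] RatFunc K) := by
  by_cases hbot : W ⊆ (⊥ : IntermediateField K (FnField K S))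
  · rw [IntermediateField.adjoin_eq_bot_iff.2 hbot]
    exact ⟨(Algebra.ofId K (RatFunc K)).comp
      (IntermediateField.botEquiv K (FnField K S) : _ →ₐ[K] K)⟩
  obtain ⟨w₀, hw₀, hw₀bot⟩ := Set.not_subset.1 hbot
  have hfrac : ∀ w : FnField K S, ∃ p q : MvPolynomial S K, q ≠ 0 ∧
      w * algebraMap _ _ q = algebraMap _ _ p := by
    intro w
    obtain ⟨p, q, hq, rfl⟩ := IsFractionRing.div_surjective (MvPolynomial S K) w
    have hq0 := nonZeroDivisors.ne_zero hq
    exact ⟨p, q, hq0, div_mul_cancel₀ _ (by simpa using hq0)⟩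
  choose p q hq hpq using hfrac
  let N := (hW.toFinset.sup fun w => max (p w).totalDegree (q w).totalDegree) + 1
  have hN : ∀ w ∈ W, (p w).totalDegree < N ∧ (q w).totalDegree < N := by
    intro w hw
    have := Finset.le_sup (f := fun w => max (p w).totalDegree (q w).totalDegree)
      (hW.mem_toFinset.2 hw)
    omega
  obtain ⟨f, -, hf⟩ := exists_equivariant_aeval_ne_zero (K := K) (M := RatFunc K) (S := S)
    (H := PUnit) 1 (fun _ _ _ => rfl) 1 (fun _ => RatFunc.X)
    ((algebraicIndependent_unique_type_iff).2 RatFunc.transcendental_X) (fun _ _ => rfl) N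
  obtain ⟨A, ψ, hA₁, hA₂, hψ⟩ := exists_extension_of_algHom (aeval (R := K) f)
  have hqw : ∀ w ∈ W, aeval f (q w) ≠ 0 := fun w hw =>
    hf _ (hq w) fun s => (degreeOf_le_totalDegree _ _).trans_lt (hN w hw).2
  have hWA : ∀ w ∈ W, w ∈ A := fun w hw => hA₁ w _ _ (hqw w hw) (hpq w)
  have htr : Transcendental K (ψ ⟨w₀, hWA w₀ hw₀⟩) := by
    refine RatFunc.transcendental_of_ne_C _ ?_
    rintro ⟨k, hk⟩
    have h1 := hψ ⟨w₀, hWA w₀ hw₀⟩ _ _ (hpq w₀)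
    have h2 : p w₀ - C k * q w₀ ≠ 0 := by
      intro h
      refine hw₀bot (IntermediateField.mem_bot.2 ⟨k, ?_⟩)
      have hq0 : algebraMap _ (FnField K S) (q w₀) ≠ 0 := by simpa using hq w₀
      apply mul_right_cancel₀ hq0
      rw [hpq, sub_eq_zero.1 h, map_mul, ← MvPolynomial.algebraMap_eq,
        ← IsScalarTower.algebraMap_apply]
    refine hf _ h2 (fun s => (degreeOf_le_totalDegree _ _).trans_lt
      ((totalDegree_sub _ _).trans_lt (max_lt (hN w₀ hw₀).1
        ((totalDegree_mul _ _).trans_lt ?_)))) ?_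
    · simpa using (hN w₀ hw₀).2
    · rw [map_sub, map_mul, ← h1, hk, aeval_C, RatFunc.algebraMap_eq_C, sub_self]
  have hinj : ∀ x : A, (x : FnField K S) ∈ E → x ≠ 0 → ψ x ≠ 0 := by
    intro x hxE hx hψx
    have h1 := AlgebraicIndependent.option_of_map_eq_zero ψ
      (fun _ : Unit => (⟨w₀, hWA w₀ hw₀⟩ : A)) ((algebraicIndependent_unique_type_iff).2 htr)
      x hx hψx
    have h2 : AlgebraicIndependent K (fun o : Option Unit =>
        (o.elim ⟨x, hxE⟩ fun _ => ⟨w₀, hWE hw₀⟩ : E)) := by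
      refine AlgebraicIndependent.of_comp E.val ?_
      convert h1.map' (f := A.val) Subtype.val_injective using 1
      ext o
      cases o <;> rfl
    have h3 := h2.lift_cardinalMk_le_trdeg
    rw [← trdeg_eq_algebraTrdeg] at h3
    have h4 := h3.trans (Cardinal.lift_le.2 hE)
    simp at h4
  have hadj : ∀ x ∈ IntermediateField.adjoin K W, x ∈ A ∧ x ∈ E := by
    intro x hx
    induction hx using IntermediateField.adjoin_induction with
    | mem x hx => exact ⟨hWA x hx, hWE hx⟩
    | algebraMap x => exact ⟨A.algebraMap_mem x, E.algebraMap_mem x⟩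
    | add x y _ _ hx hy => exact ⟨A.add_mem hx.1 hy.1, E.add_mem hx.2 hy.2⟩
    | inv x _ hx =>
      refine ⟨?_, E.inv_mem hx.2⟩
      rcases eq_or_ne x 0 with rfl | hx0
      · rw [inv_zero]
        exact A.zero_mem
      obtain ⟨p, q, hq, hpq⟩ := hA₂ x hx.1
      refine hA₁ _ q p ?_ ?_
      · rw [← hψ ⟨x, hx.1⟩ p q hpq]
        exact mul_ne_zero (hinj ⟨x, hx.1⟩ hx.2 fun h => hx0 (congrArg Subtype.val h)) hq
      · rw [← hpq, inv_mul_cancel_left₀ hx0]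
    | mul x y _ _ hx hy => exact ⟨A.mul_mem hx.1 hy.1, E.mul_mem hx.2 hy.2⟩
  exact ⟨ψ.comp (Subalgebra.inclusion (S := (IntermediateField.adjoin K W).toSubalgebra) (T := A)
    fun x hx => (hadj x hx).1)⟩

/-- An automorphism preserving a set restricts to the subfield generated by the set. -/
theorem exists_restrict_adjoin {K F : Type*} [Field K] [Field F] [Algebra K F] (τ : F ≃ₐ[K] F)
    (W : Set F) (hW : ∀ x ∈ W, τ x ∈ W) :
    ∃ s : IntermediateField.adjoin K W →ₐ[K] IntermediateField.adjoin K W,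
      ∀ (k : ℕ) x, (((s ^ k) x : IntermediateField.adjoin K W) : F) = (τ ^ k) x := by
  have hstab : IntermediateField.adjoin K W ≤
      (IntermediateField.adjoin K W).comap (τ : F →ₐ[K] F) :=
    IntermediateField.adjoin_le_iff.2 fun x hx => IntermediateField.subset_adjoin _ _ (hW x hx)
  let s : IntermediateField.adjoin K W →ₐ[K] IntermediateField.adjoin K W :=
    ((τ : F →ₐ[K] F).comp (IntermediateField.adjoin K W).val).codRestrict
      (IntermediateField.adjoin K W).toSubalgebra fun x => hstab x.2
  refine ⟨s, fun k => ?_⟩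
  induction k with
  | zero => simp
  | succ k ih =>
    intro x
    rw [pow_succ', pow_succ', AlgHom.mul_apply, AlgEquiv.mul_apply, ← ih]
    rfl

/-- In characteristic two, a group containing an element of order six has essential dimension at
least two. -/
theorem two_le_edK_of_orderOf_eq_six (K : Type u) {G : Type} [Field K] [CharP K 2] [Group G]
    [Finite G] {g : G} (hg : orderOf g = 6) : 2 ≤ edK K G := by
  by_contra! hlt
  obtain ⟨E, hE, hEf, hd⟩ := exists_trdeg_eq_edK K G
  have hd1 : trdeg K E ≤ 1 := by
    rw [hd]
    exact_mod_cast Nat.lt_succ_iff.1 hlt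
  obtain ⟨a, haE, ha⟩ := hEf (g ^ 2) (pow_ne_one_of_lt_orderOf (by norm_num) (by omega))
  obtain ⟨b, hbE, hb⟩ := hEf (g ^ 3) (pow_ne_one_of_lt_orderOf (by norm_num) (by omega))
  let W : Set (FnField K G) :=
    Set.range (fun h => galAction K G h a) ∪ Set.range (fun h => galAction K G h b)
  have haW : a ∈ W := Or.inl ⟨1, by simp⟩
  have hbW : b ∈ W := Or.inr ⟨1, by simp⟩
  have hWE : W ⊆ E := by
    rintro _ (⟨h, rfl⟩ | ⟨h, rfl⟩)
    exacts [hE h a haE, hE h b hbE]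
  obtain ⟨θ⟩ := exists_algHom_ratFunc E hd1 W ((Set.finite_range _).union (Set.finite_range _)) hWE
  obtain ⟨s, hs⟩ := exists_restrict_adjoin (galAction K G g) W (by
    rintro _ (⟨h, rfl⟩ | ⟨h, rfl⟩)
    · exact Or.inl ⟨g * h, by dsimp only; rw [map_mul, AlgEquiv.mul_apply]⟩
    · exact Or.inr ⟨g * h, by dsimp only; rw [map_mul, AlgEquiv.mul_apply]⟩)
  simp only [← map_pow] at hs
  have hne : ∀ k, ∀ x ∈ W, s ^ k = 1 → galAction K G (g ^ k) x = x := by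
    intro k x hx hk
    rw [← hs k ⟨x, IntermediateField.subset_adjoin _ _ hx⟩, hk, AlgHom.one_apply]
  have h6 : s ^ 6 = 1 := by
    ext x
    rw [hs, ← hg, pow_orderOf_eq_one, map_one, AlgEquiv.one_apply, AlgHom.one_apply]
  rcases pow_two_eq_one_or_pow_three_eq_one_of_algHom_ratFunc θ s h6 with h | h
  · exact ha (hne 2 a haW h)
  · exact hb (hne 3 b hbW h)

theorem one_le_edK (K : Type u) {G : Type} [Field K] [Group G] [Finite G] [Nontrivial G] :
    1 ≤ edK K G := by
  refine (Nat.one_le_iff_ne_zero.2 fun h0 => ?_).trans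
    (edK_le_of_algebra K (AlgebraicClosure K) G)
  obtain ⟨E, hE, hEf, hd⟩ := exists_trdeg_eq_edK (AlgebraicClosure K) G
  rw [h0, Nat.cast_zero, trdeg_eq_algebraTrdeg, _root_.trdeg_eq_zero_iff] at hd
  obtain ⟨g, hg⟩ := exists_ne (1 : G)
  obtain ⟨x, hx, hgx⟩ := hEf g hg
  obtain ⟨k, hk⟩ := IsAlgClosed.algebraMap_bijective_of_isIntegral
    (k := AlgebraicClosure K) (K := E) |>.2 ⟨x, hx⟩
  apply hgx
  have : x = algebraMap (AlgebraicClosure K) _ k := (congrArg Subtype.val hk).symm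
  rw [this, AlgEquiv.commutes]

theorem edK_perm_two_le_one (K : Type u) [Field K] : edK K (Equiv.Perm (Fin 2)) ≤ 1 := by
  let x : Equiv.Perm (Fin 2) → FnField K (Equiv.Perm (Fin 2)) :=
    fun s => algebraMap _ _ (X s : MvPolynomial _ K)
  have hx : ∀ g s, galAction K _ g (x s) = x (g * s) := galAction_X
  have hx0 : ∀ g, x g ≠ 0 := fun g => by simp [x]
  let σ : Equiv.Perm (Fin 2) := Equiv.swap 0 1
  have hσ : ∀ g : Equiv.Perm (Fin 2), g = 1 ∨ g = σ := by decide
  have hσσ : σ * σ = 1 := by decide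
  have hσx : galAction K _ σ (x 1 / x σ) = (x 1 / x σ)⁻¹ := by
    rw [map_div₀, hx, hx, mul_one, hσσ, inv_div]
  refine edK_le_of (IntermediateField.adjoin K {x 1 / x σ}) ?_ ?_ (d := 1) ?_
  · intro g y hy
    rcases hσ g with rfl | rfl
    · simpa using hy
    have hle : IntermediateField.adjoin K {x 1 / x σ} ≤
        (IntermediateField.adjoin K {x 1 / x σ}).comap
          (galAction K _ σ : FnField K (Equiv.Perm (Fin 2)) →ₐ[K] _) := by
      rw [IntermediateField.adjoin_le_iff, Set.singleton_subset_iff]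
      change galAction K _ σ (x 1 / x σ) ∈ IntermediateField.adjoin K {x 1 / x σ}
      rw [hσx]
      exact inv_mem (IntermediateField.mem_adjoin_simple_self _ _)
    exact hle hy
  · intro g hg
    obtain rfl := (hσ g).resolve_left hg
    refine ⟨_, IntermediateField.mem_adjoin_simple_self _ _, fun h => ?_⟩
    rw [hσx, inv_div, div_eq_div_iff (hx0 _) (hx0 _), ← pow_two, ← pow_two] at h
    have h' : (X σ ^ 2 : MvPolynomial (Equiv.Perm (Fin 2)) K) = X 1 ^ 2 :=
      FaithfulSMul.algebraMap_injective _ (FnField K (Equiv.Perm (Fin 2))) (by simpa [x] using h)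
    have h2 := congrArg (aeval (R := K) fun s => if s = σ then (1 : K) else 0) h'
    have h1σ : (1 : Equiv.Perm (Fin 2)) ≠ σ := by decide
    simp [h1σ] at h2
  · refine trdeg_adjoin_le _ _ fun t ht _ => ?_
    simpa using Cardinal.mk_le_mk_of_subset ht

theorem edK_perm_mono (K : Type u) [Field K] {m n : ℕ} (h : m ≤ n) :
    edK K (Equiv.Perm (Fin m)) ≤ edK K (Equiv.Perm (Fin n)) :=
  edK_le_of_injective K (Equiv.Perm.viaEmbeddingHom (Fin.castLEEmb h))
    (Equiv.Perm.viaEmbeddingHom_injective _)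

theorem edK_perm_two_add_one_le (K : Type u) [Field K] [CharP K 2] :
    edK K (Equiv.Perm (Fin 2)) + 1 ≤ edK K (Equiv.Perm (Fin 5)) := by
  refine (Nat.succ_le_succ (edK_perm_two_le_one K)).trans (two_le_edK_of_orderOf_eq_six K
    (g := Equiv.swap 0 1 * (Equiv.swap 2 3 * Equiv.swap 3 4)) ?_)
  refine orderOf_eq_of_pow_and_pow_div_prime (by norm_num) (by decide) fun p hp hp6 => ?_
  have : p ≤ 6 := Nat.le_of_dvd (by norm_num) hp6
  interval_cases p
  all_goals first | (exact absurd hp6 (by decide)) | skip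
  · exact absurd hp (by norm_num)
  · decide
  · decide
  · exact absurd hp (by norm_num)

theorem three_ne_zero_of_charP_two (K : Type*) [Field K] [CharP K 2] : (3 : K) ≠ 0 := by
  rw [show (3 : K) = 2 + 1 by norm_num, CharTwo.two_eq_zero, zero_add]
  exact one_ne_zero

theorem edK_perm_add_one_le_of_charP_two (K : Type u) [Field K] [CharP K 2] {ζ : K}
    (hζ : IsPrimitiveRoot ζ 3) (n : ℕ) (hn : 1 ≤ n) (hn4 : n ≠ 4) :
    edK K (Equiv.Perm (Fin n)) + 1 ≤ edK K (Equiv.Perm (Fin (n + 3))) := by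
  rcases eq_or_ne n 2 with rfl | hn2
  · exact edK_perm_two_add_one_le K
  · exact edK_perm_add_one_le K hζ (three_ne_zero_of_charP_two K) n (by omega)

theorem le_edK_perm_of_charP_two (K : Type u) [Field K] [CharP K 2] (n : ℕ) :
    (n + 1) / 3 ≤ edK K (Equiv.Perm (Fin n)) := by
  let K' := AlgebraicClosure K
  have : CharP K' 2 := charP_of_injective_algebraMap (algebraMap K K').injective 2
  have : NeZero ((3 : ℕ) : K') := ⟨by exact_mod_cast three_ne_zero_of_charP_two K'⟩
  obtain ⟨ζ, hζ⟩ := HasEnoughRootsOfUnity.exists_primitiveRoot K' 3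
  have key : ∀ j : ℕ, j + 1 ≤ edK K' (Equiv.Perm (Fin (2 + 3 * j))) := by
    intro j
    induction j with
    | zero => exact one_le_edK K'
    | succ j ih =>
      exact (Nat.succ_le_succ ih).trans
        (edK_perm_add_one_le_of_charP_two K' hζ (2 + 3 * j) (by omega) (by omega))
  rcases Nat.eq_zero_or_pos ((n + 1) / 3) with h0 | h0
  · omega
  · have h1 := (key ((n + 1) / 3 - 1)).trans
      ((edK_perm_mono K' (by omega)).trans (edK_le_of_algebra K K' (Equiv.Perm (Fin n))))
    omega

/-- (a) If `char K = 2` and `K` contains a primitive cube root of unity (i.e. `K ⊇ F₄`),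
then `ed_K(S_{n+3}) ≥ ed_K(Sₙ) + 1` for every `n ≥ 1` with `n ≠ 4`.
(b) If `char K = 2`, then `ed_K(Sₙ) ≥ ⌊(n+1)/3⌋` for every `n ≥ 1`. -/
theorem edK_symmGroup_char_two :
    (∀ (K : Type u) [Field K], ringChar K = 2 → (∃ ζ : K, IsPrimitiveRoot ζ 3) →
      ∀ n : ℕ, 1 ≤ n → n ≠ 4 →
        edK K (Equiv.Perm (Fin n)) + 1 ≤ edK K (Equiv.Perm (Fin (n + 3)))) ∧
    (∀ (K : Type u) [Field K], ringChar K = 2 →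
      ∀ n : ℕ, 1 ≤ n → (n + 1) / 3 ≤ edK K (Equiv.Perm (Fin n))) := by
  refine ⟨fun K _ hK ⟨ζ, hζ⟩ n hn hn4 => ?_, fun K _ hK n _ => ?_⟩
  · have : CharP K 2 := ringChar.of_eq hK
    exact edK_perm_add_one_le_of_charP_two K hζ n hn hn4
  · have : CharP K 2 := ringChar.of_eq hK
    exact le_edK_perm_of_charP_two K n
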